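/- Suppose λ/μ and α/β are basic skew diagrams with s_{λ/μ} = s_{α/β}, and λ/μ has a row of full length λ_1 (some row equal to λ_1 boxes) and a column of full height length(λ). Then α/β equals λ/μ or equals the 180°-rotation of λ/μ (up to translation). -/

import Mathlib

open YoungDiagram
open scoped Classical

namespace LRSkew

/-- The cells of the skew diagram `lam/mu`. -/
def skewCells (lam mu : YoungDiagram) : Finset (ℕ × ℕ) := lam.cells \ mu.cells

/-- A semistandard filling of the skew shape `lam/mu`: entries are positive exactly on the
cells of the shape, rows are weakly increasing and columns are strictly increasing. -/
def IsSSYT (lam mu : YoungDiagram) (T : ℕ × ℕ → ℕ) : Prop :=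
  (∀ p, p ∈ skewCells lam mu ↔ T p ≠ 0) ∧
  (∀ i j1 j2, (i, j1) ∈ skewCells lam mu → (i, j2) ∈ skewCells lam mu → j1 ≤ j2 →
    T (i, j1) ≤ T (i, j2)) ∧
  (∀ i1 i2 j, (i1, j) ∈ skewCells lam mu → (i2, j) ∈ skewCells lam mu → i1 < i2 →
    T (i1, j) < T (i2, j))

/-- The number of entries equal to `k` among the cells read (in the reverse reading word:
right to left along rows, top row first) up to position `(i,j)`. -/
def prefixCount (lam mu : YoungDiagram) (T : ℕ × ℕ → ℕ) (i j k : ℕ) : ℕ :=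
  ((skewCells lam mu).filter fun p => (p.1 < i ∨ (p.1 = i ∧ j ≤ p.2)) ∧ T p = k).card

/-- The reverse reading word of the filling is a lattice word. -/
def IsLattice (lam mu : YoungDiagram) (T : ℕ × ℕ → ℕ) : Prop :=
  ∀ i j k, prefixCount lam mu T i j (k + 2) ≤ prefixCount lam mu T i j (k + 1)

/-- The number of entries of the filling equal to `k`. -/
def content (lam mu : YoungDiagram) (T : ℕ × ℕ → ℕ) (k : ℕ) : ℕ :=
  ((skewCells lam mu).filter fun p => T p = k).card

/-- A Littlewood–Richardson tableau of shape `lam/mu` and content `nu`. -/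
def IsLR (lam mu nu : YoungDiagram) (T : ℕ × ℕ → ℕ) : Prop :=
  IsSSYT lam mu T ∧ IsLattice lam mu T ∧ ∀ i, content lam mu T (i + 1) = nu.rowLen i

/-- The Littlewood–Richardson coefficient `c(lam; mu, nu)`. -/
noncomputable def lrCoeff (lam mu nu : YoungDiagram) : ℕ :=
  if mu ≤ lam then {T : ℕ × ℕ → ℕ | IsLR lam mu nu T}.ncard else 0

/-- Equality of the skew Schur functions `s_{lam/mu} = s_{alp/bet}`, expressed through
their expansions into Schur functions. -/
def SchurEq (lam mu alp bet : YoungDiagram) : Prop :=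
  ∀ nu : YoungDiagram, lrCoeff lam mu nu = lrCoeff alp bet nu

/-- The rectangular Young diagram `(k^l)` with `l` rows of length `k`. -/
def rect (k l : ℕ) : YoungDiagram :=
  ⟨Finset.range l ×ˢ Finset.range k, by
    intro a b hba ha
    simp only [Finset.coe_product, Set.mem_prod, Finset.mem_coe, Finset.mem_range] at ha ⊢
    exact ⟨lt_of_le_of_lt hba.1 ha.1, lt_of_le_of_lt hba.2 ha.2⟩⟩

/-- The complement of `nu` in the rectangle `(k^l)`, rotated by 180 degrees so that it is
again a partition: its parts are `(k - nu_l, …, k - nu_1)`. -/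
def complRect (k l : ℕ) (nu : YoungDiagram) : YoungDiagram :=
  ⟨(rect k l).cells.filter fun p => (l - 1 - p.1, k - 1 - p.2) ∉ nu, by
    intro a b hba ha
    simp only [Finset.coe_filter, Set.mem_setOf_eq, mem_cells] at ha ⊢
    refine ⟨(rect k l).isLowerSet hba ha.1, fun hmem => ha.2 ?_⟩
    exact nu.isLowerSet
      (Prod.mk_le_mk.mpr ⟨Nat.sub_le_sub_left hba.1 _, Nat.sub_le_sub_left hba.2 _⟩) hmem⟩

/-- The staircase partition `(n, n-1, …, 2, 1)`. -/
def staircase (n : ℕ) : YoungDiagram :=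
  ⟨(Finset.range n ×ˢ Finset.range n).filter fun p => p.1 + p.2 < n, by
    intro a b hba ha
    simp only [Finset.coe_filter, Set.mem_setOf_eq, Finset.mem_product, Finset.mem_range] at ha ⊢
    exact ⟨⟨lt_of_le_of_lt hba.1 ha.1.1, lt_of_le_of_lt hba.2 ha.1.2⟩,
      lt_of_le_of_lt (Nat.add_le_add hba.1 hba.2) ha.2⟩⟩

/-- A basic skew diagram: no empty rows and no empty columns. -/
def IsBasic (lam mu : YoungDiagram) : Prop :=
  (∀ i, i < lam.colLen 0 → mu.rowLen i < lam.rowLen i) ∧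
  (∀ j, j < lam.rowLen 0 → mu.colLen j < lam.colLen j)

/-- A (basic) skew diagram is connected iff consecutive rows share a column. -/
def IsConnectedSkew (lam mu : YoungDiagram) : Prop :=
  ∀ i, i + 1 < lam.colLen 0 → mu.rowLen i < lam.rowLen (i + 1)

/-- The number of distinct (positive) part sizes of a partition. -/
def dp (lam : YoungDiagram) : ℕ :=
  ((Finset.range (lam.colLen 0)).image fun i => lam.rowLen i).card

/-- A partition is a rectangle: all its parts are equal. -/
def IsRect (mu : YoungDiagram) : Prop :=
  ∀ i, i < mu.colLen 0 → mu.rowLen i = mu.rowLen 0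

/-- Cells of a skew diagram in the same connected component: the reflexive–transitive
closure of sharing a row or a column. -/
def SameComp (s : Finset (ℕ × ℕ)) : ℕ × ℕ → ℕ × ℕ → Prop :=
  Relation.ReflTransGen fun a b => a ∈ s ∧ b ∈ s ∧ (a.1 = b.1 ∨ a.2 = b.2)

/-- Two finite sets of boxes agree up to translation or 180°-rotation of each connected
component independently. -/
def UpToTransRot (s t : Finset (ℕ × ℕ)) : Prop :=
  ∃ f : ℕ × ℕ → ℕ × ℕ, Set.BijOn f ↑s ↑t ∧
    ∀ p ∈ s, ∀ q ∈ s, SameComp s p q →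
      (((f q).1 : ℤ) - (f p).1 = (q.1 : ℤ) - p.1 ∧ ((f q).2 : ℤ) - (f p).2 = (q.2 : ℤ) - p.2) ∨
      (((f q).1 : ℤ) - (f p).1 = (p.1 : ℤ) - q.1 ∧ ((f q).2 : ℤ) - (f p).2 = (p.2 : ℤ) - q.2)


/-! ### Alternants -/

/-- The alternant `det (x_i ^ e_j)`. -/
noncomputable def alt (n : ℕ) (e : Fin n → ℕ) : MvPolynomial (Fin n) ℤ :=
  Matrix.det (Matrix.of fun i j : Fin n => (MvPolynomial.X i : MvPolynomial (Fin n) ℤ) ^ e j)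

/-- The alternant viewed as a polynomial in the first variable, divided by its lowest power. -/
noncomputable def altQ {n : ℕ} (e : Fin (n + 1) → ℕ) : Polynomial (MvPolynomial (Fin n) ℤ) :=
  ∑ j : Fin (n + 1), Polynomial.C ((-1) ^ (j : ℕ) * alt n (fun i => e (j.succAbove i))) *
    Polynomial.X ^ (e j - e 0)

lemma alt_succ {n : ℕ} (e : Fin (n + 1) → ℕ) (he : StrictMono e) :
    MvPolynomial.finSuccEquiv ℤ n (alt (n + 1) e) = Polynomial.X ^ (e 0) * altQ e := by
  unfold alt
  rw [Matrix.det_succ_row_zero, map_sum, altQ, Finset.mul_sum]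
  refine Finset.sum_congr rfl fun j _ => ?_
  have h0 : e 0 ≤ e j := he.monotone (Fin.zero_le j)
  have hd : MvPolynomial.finSuccEquiv ℤ n
      (((Matrix.of fun i j : Fin (n+1) => (MvPolynomial.X i : MvPolynomial (Fin (n+1)) ℤ) ^ e j).submatrix
        Fin.succ j.succAbove).det) = Polynomial.C (alt n (fun i => e (j.succAbove i))) := by
    unfold alt
    rw [RingHom.map_det, AlgEquiv.map_det]
    congr 1
    ext1 a b
    simp [Matrix.submatrix, MvPolynomial.finSuccEquiv_X_succ]
  rw [map_mul, map_mul, hd]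
  simp only [Matrix.of_apply, map_pow, MvPolynomial.finSuccEquiv_X_zero, map_neg, map_one, map_mul]
  have : (Polynomial.X : Polynomial (MvPolynomial (Fin n) ℤ)) ^ e j
      = Polynomial.X ^ e 0 * Polynomial.X ^ (e j - e 0) := by
    rw [← pow_add]; congr 1; omega
  rw [this]; ring

lemma altQ_coeff {n : ℕ} (e : Fin (n + 1) → ℕ) (d : ℕ) :
    (altQ e).coeff d = ∑ j : Fin (n + 1), if d = e j - e 0 then
      ((-1) ^ (j : ℕ) * alt n (fun i => e (j.succAbove i))) else 0 := by
  unfold altQ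
  rw [Polynomial.finsetSum_coeff]
  refine Finset.sum_congr rfl fun j _ => ?_
  rw [Polynomial.coeff_C_mul_X_pow]

lemma altQ_coeff_zero {n : ℕ} (e : Fin (n + 1) → ℕ) (he : StrictMono e) :
    (altQ e).coeff 0 = alt n (fun i => e i.succ) := by
  rw [altQ_coeff, Finset.sum_eq_single 0]
  · simp
  · intro j _ hj
    have : e 0 < e j := he (Fin.pos_of_ne_zero hj)
    rw [if_neg (by omega)]
  · simp

lemma altQ_coeff_lt {n : ℕ} (e : Fin (n + 2) → ℕ) (he : StrictMono e) (d : ℕ) (h0 : 0 < d)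
    (h1 : d < e 1 - e 0) : (altQ e).coeff d = 0 := by
  rw [altQ_coeff]
  refine Finset.sum_eq_zero fun j _ => ?_
  rw [if_neg]
  rcases Nat.eq_zero_or_pos (j : ℕ) with hj | hj
  · have : j = 0 := Fin.ext hj
    subst this; omega
  · have : e 1 ≤ e j := he.monotone (by rw [Fin.le_def]; simp only [Fin.val_one]; omega)
    omega

lemma altQ_coeff_gap {n : ℕ} (e : Fin (n + 2) → ℕ) (he : StrictMono e) :
    (altQ e).coeff (e 1 - e 0) = - alt (n + 1) (fun i => e ((1 : Fin (n+2)).succAbove i)) := by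
  rw [altQ_coeff, Finset.sum_eq_single 1]
  · simp
  · intro j _ hj
    rw [if_neg]
    have h01 : e 0 < e 1 := he (by rw [Fin.lt_def]; simp)
    rcases Nat.eq_zero_or_pos (j : ℕ) with hj' | hj'
    · have : j = 0 := Fin.ext hj'
      subst this; omega
    · have : e 1 < e j := he (by
        rw [Fin.lt_def]
        have : (j : ℕ) ≠ 1 := fun h => hj (Fin.ext (by simpa using h))
        simp; omega)
      omega
  · simp

lemma strictMono_comp_succ {n : ℕ} {e : Fin (n + 1) → ℕ} (he : StrictMono e) :
    StrictMono (fun i : Fin n => e i.succ) := fun _ _ h => he (Fin.succ_lt_succ_iff.2 h)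

lemma strictMono_comp_above {n : ℕ} {e : Fin (n + 1) → ℕ} (he : StrictMono e) (j : Fin (n+1)) :
    StrictMono (fun i : Fin n => e (j.succAbove i)) :=
  fun _ _ h => he (Fin.strictMono_succAbove j h)

lemma alt_ne_zero : ∀ (n : ℕ) (e : Fin n → ℕ), StrictMono e → alt n e ≠ 0
  | 0, e, _ => by simp [alt]
  | n + 1, e, he => by
    intro h
    have h1 := alt_succ e he
    rw [h, map_zero] at h1
    have h2 : altQ e = 0 := by
      rcases mul_eq_zero.1 h1.symm with h | h
      · exact absurd h (pow_ne_zero _ Polynomial.X_ne_zero)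
      · exact h
    have h3 := altQ_coeff_zero e he
    rw [h2, Polynomial.coeff_zero] at h3
    exact alt_ne_zero n _ (strictMono_comp_succ he) h3.symm

/-- Equality of unordered pairs up to opposite shifts. -/
def PairRel {n : ℕ} (M N A B : Fin n → ℕ) : Prop :=
  (∃ c : ℤ, ∀ i, (A i : ℤ) = M i + c ∧ (B i : ℤ) = N i - c) ∨
  (∃ c : ℤ, ∀ i, (A i : ℤ) = N i + c ∧ (B i : ℤ) = M i - c)

lemma PairRel.swapR {n : ℕ} {M N A B : Fin n → ℕ} (h : PairRel M N A B) : PairRel M N B A := by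
  rcases h with ⟨c, h⟩ | ⟨c, h⟩
  · exact Or.inr ⟨-c, fun i => ⟨by have := h i; omega, by have := h i; omega⟩⟩
  · exact Or.inl ⟨-c, fun i => ⟨by have := h i; omega, by have := h i; omega⟩⟩

lemma PairRel.swapL {n : ℕ} {M N A B : Fin n → ℕ} (h : PairRel M N A B) : PairRel N M A B := by
  rcases h with ⟨c, h⟩ | ⟨c, h⟩
  · exact Or.inr ⟨c, h⟩
  · exact Or.inl ⟨c, h⟩

lemma coeff_mul_gap {R : Type*} [CommRing R] (p q : Polynomial R) (d : ℕ) (hd : 0 < d)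
    (h : ∀ a, 0 < a → a < d → p.coeff a = 0 ∨ ∀ b, a + b = d → q.coeff b = 0) :
    (p * q).coeff d = p.coeff 0 * q.coeff d + p.coeff d * q.coeff 0 := by
  rw [Polynomial.coeff_mul]
  have : ∑ x ∈ Finset.HasAntidiagonal.antidiagonal d, p.coeff x.1 * q.coeff x.2
      = ∑ x ∈ ({(0, d), (d, 0)} : Finset (ℕ × ℕ)), p.coeff x.1 * q.coeff x.2 := by
    symm
    apply Finset.sum_subset
    · intro x hx
      simp only [Finset.mem_insert, Finset.mem_singleton] at hx
      rcases hx with rfl | rfl <;> simp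
    · rintro ⟨a, b⟩ hx hx'
      simp only [Finset.HasAntidiagonal.mem_antidiagonal] at hx
      simp only [Finset.mem_insert, Finset.mem_singleton, Prod.mk.injEq, not_or] at hx'
      rcases h a (by omega) (by omega) with h | h
      · simp [h]
      · simp [h b hx]
  rw [this, Finset.sum_pair]
  simp; omega

lemma alt_core {m : ℕ} (ih : ∀ M N A B : Fin (m + 1) → ℕ, StrictMono M → StrictMono N →
      StrictMono A → StrictMono B → alt _ M * alt _ N = alt _ A * alt _ B → PairRel M N A B)
    (M N A B : Fin (m + 2) → ℕ) (hM : StrictMono M) (hN : StrictMono N)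
    (hA : StrictMono A) (hB : StrictMono B) (h0 : M 0 + N 0 = A 0 + B 0)
    (hQ : altQ M * altQ N = altQ A * altQ B) (c : ℤ)
    (hc : ∀ i : Fin (m + 1), (A i.succ : ℤ) = M i.succ + c ∧ (B i.succ : ℤ) = N i.succ - c)
    (hg : M 1 - M 0 ≤ N 1 - N 0) : PairRel M N A B := by
  have lM : M 0 < M 1 := hM (by rw [Fin.lt_def]; simp)
  have lN : N 0 < N 1 := hN (by rw [Fin.lt_def]; simp)
  have lA : A 0 < A 1 := hA (by rw [Fin.lt_def]; simp)
  have lB : B 0 < B 1 := hB (by rw [Fin.lt_def]; simp)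
  have hc0 := hc 0
  simp only [Fin.succ_zero_eq_one] at hc0
  have hgs : (M 1 - M 0) + (N 1 - N 0) = (A 1 - A 0) + (B 1 - B 0) := by omega
  have uM := alt_ne_zero _ _ (strictMono_comp_succ hM)
  have uN := alt_ne_zero _ _ (strictMono_comp_succ hN)
  have uA := alt_ne_zero _ _ (strictMono_comp_succ hA)
  have uB := alt_ne_zero _ _ (strictMono_comp_succ hB)
  have vM := alt_ne_zero _ _ (strictMono_comp_above hM 1)
  have vN := alt_ne_zero _ _ (strictMono_comp_above hN 1)
  have vA := alt_ne_zero _ _ (strictMono_comp_above hA 1)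
  have vB := alt_ne_zero _ _ (strictMono_comp_above hB 1)
  have kL : ∀ d, 0 < d → d ≤ N 1 - N 0 → (altQ M * altQ N).coeff d =
      (altQ M).coeff 0 * (altQ N).coeff d + (altQ M).coeff d * (altQ N).coeff 0 := by
    intro d hd hd'
    refine coeff_mul_gap _ _ _ hd fun a ha ha' => Or.inr fun b hb => ?_
    exact altQ_coeff_lt _ hN _ (by omega) (by omega)
  have kR : ∀ d, 0 < d → d ≤ A 1 - A 0 ∨ d ≤ B 1 - B 0 → (altQ A * altQ B).coeff d =
      (altQ A).coeff 0 * (altQ B).coeff d + (altQ A).coeff d * (altQ B).coeff 0 := by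
    intro d hd hd'
    refine coeff_mul_gap _ _ _ hd fun a ha ha' => ?_
    rcases hd' with hd' | hd'
    · exact Or.inl (altQ_coeff_lt _ hA _ (by omega) (by omega))
    · exact Or.inr fun b hb => altQ_coeff_lt _ hB _ (by omega) (by omega)
  rw [hQ] at kL
  have gA : A 1 - A 0 = M 1 - M 0 ∨ (B 1 - B 0 = M 1 - M 0 ∧ M 1 - M 0 < N 1 - N 0) := by
    by_contra hcon
    push Not at hcon
    obtain ⟨hn1, hn2⟩ := hcon
    by_cases hlt : A 1 - A 0 < M 1 - M 0
    · have e1 := kL (A 1 - A 0) (by omega) (by omega)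
      rw [kR _ (by omega) (by omega), altQ_coeff_lt N hN (A 1 - A 0) (by omega) (by omega),
        altQ_coeff_lt M hM (A 1 - A 0) (by omega) (by omega), altQ_coeff_gap A hA,
        altQ_coeff_lt B hB (A 1 - A 0) (by omega) (by omega), altQ_coeff_zero B hB] at e1
      simp only [mul_zero, zero_mul, zero_add, add_zero, mul_eq_zero, neg_eq_zero] at e1
      exact e1.elim vA uB
    · by_cases hlt' : B 1 - B 0 < M 1 - M 0
      · have e1 := kL (B 1 - B 0) (by omega) (by omega)
        rw [kR _ (by omega) (by omega), altQ_coeff_lt N hN (B 1 - B 0) (by omega) (by omega),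
          altQ_coeff_lt M hM (B 1 - B 0) (by omega) (by omega), altQ_coeff_gap B hB,
          altQ_coeff_lt A hA (B 1 - B 0) (by omega) (by omega), altQ_coeff_zero A hA] at e1
        simp only [mul_zero, zero_mul, zero_add, add_zero, mul_eq_zero, neg_eq_zero] at e1
        exact e1.elim uA vB
      · have e1 := kL (M 1 - M 0) (by omega) (by omega)
        rw [kR _ (by omega) (by omega), altQ_coeff_lt N hN (M 1 - M 0) (by omega) (by omega),
          altQ_coeff_lt A hA (M 1 - M 0) (by omega) (by omega), altQ_coeff_gap M hM,
          altQ_coeff_lt B hB (M 1 - M 0) (by omega) (by omega), altQ_coeff_zero N hN] at e1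
        simp only [mul_zero, zero_mul, zero_add, zero_eq_mul, neg_eq_zero] at e1
        exact e1.elim vM uN
  rcases gA with gA | ⟨gB, gMN⟩
  · refine Or.inl ⟨c, fun i => ?_⟩
    refine Fin.cases ?_ (fun i => hc i) i
    constructor <;> omega
  · have gA : A 1 - A 0 = N 1 - N 0 := by omega
    have e1 := kL (M 1 - M 0) (by omega) (by omega)
    rw [kR _ (by omega) (by omega), altQ_coeff_lt N hN (M 1 - M 0) (by omega) (by omega),
      altQ_coeff_lt A hA (M 1 - M 0) (by omega) (by omega), altQ_coeff_gap M hM, altQ_coeff_zero A hA,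
      altQ_coeff_zero N hN, ← gB, altQ_coeff_gap B hB] at e1
    have e2 : alt (m+1) (fun i => N i.succ) * alt (m+1) (fun i => M ((1 : Fin (m+2)).succAbove i))
        = alt (m+1) (fun i => A i.succ) * alt (m+1) (fun i => B ((1 : Fin (m+2)).succAbove i)) := by
      linear_combination e1
    have e3 := ih _ _ _ _ (strictMono_comp_succ hN) (strictMono_comp_above hM 1)
      (strictMono_comp_succ hA) (strictMono_comp_above hB 1) e2
    rcases e3 with ⟨d, e3⟩ | ⟨d, e3⟩
    · refine Or.inr ⟨d, fun i => ?_⟩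
      have e30 := e3 0
      simp at e30
      refine Fin.cases ?_ (fun i => ?_) i
      · constructor <;> omega
      · have := hc i
        have := e3 i
        dsimp only at this
        constructor <;> omega
    · have e30 := e3 0
      simp at e30
      rcases Nat.eq_zero_or_pos m with rfl | hm
      · refine Or.inr ⟨(A 1 : ℤ) - N 1, fun i => ?_⟩
        fin_cases i
        · simp; constructor <;> omega
        · simp; omega
      · exfalso
        obtain ⟨m, rfl⟩ : ∃ m', m = m' + 1 := ⟨m - 1, by omega⟩
        have e31 := e3 1
        have hc1 := hc 1
        have : (1 : Fin (m + 1 + 2)).succAbove 1 = (1 : Fin (m+1+1)).succ := by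
          ext; simp [Fin.succAbove, Fin.lt_def]
        dsimp only at e31
        rw [this] at e31
        omega

theorem alt_unique : ∀ (n : ℕ) (M N A B : Fin n → ℕ), StrictMono M → StrictMono N →
      StrictMono A → StrictMono B → alt _ M * alt _ N = alt _ A * alt _ B → PairRel M N A B := by
  intro n
  induction n with
  | zero => intro M N A B _ _ _ _ _; exact Or.inl ⟨0, fun i => i.elim0⟩
  | succ n ih =>
    intro M N A B hM hN hA hB h
    have h1 := congrArg (MvPolynomial.finSuccEquiv ℤ n) h
    rw [map_mul, map_mul, alt_succ _ hM, alt_succ _ hN, alt_succ _ hA, alt_succ _ hB] at h1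
    have h2 : Polynomial.X ^ (M 0 + N 0) * (altQ M * altQ N)
        = Polynomial.X ^ (A 0 + B 0) * (altQ A * altQ B) := by
      rw [pow_add, pow_add]; linear_combination h1
    have nz1 : (altQ M * altQ N).coeff 0 ≠ 0 := by
      rw [Polynomial.mul_coeff_zero, altQ_coeff_zero _ hM, altQ_coeff_zero _ hN]
      exact mul_ne_zero (alt_ne_zero _ _ (strictMono_comp_succ hM))
        (alt_ne_zero _ _ (strictMono_comp_succ hN))
    have nz2 : (altQ A * altQ B).coeff 0 ≠ 0 := by
      rw [Polynomial.mul_coeff_zero, altQ_coeff_zero _ hA, altQ_coeff_zero _ hB]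
      exact mul_ne_zero (alt_ne_zero _ _ (strictMono_comp_succ hA))
        (alt_ne_zero _ _ (strictMono_comp_succ hB))
    have h0 : M 0 + N 0 = A 0 + B 0 := by
      rcases lt_trichotomy (M 0 + N 0) (A 0 + B 0) with hl | hl | hl
      · have := congrArg (fun p => p.coeff (M 0 + N 0)) h2
        simp only [Polynomial.coeff_X_pow_mul'] at this
        rw [if_pos le_rfl, if_neg (by omega), Nat.sub_self] at this
        exact absurd this nz1
      · exact hl
      · have := congrArg (fun p => p.coeff (A 0 + B 0)) h2
        simp only [Polynomial.coeff_X_pow_mul'] at this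
        rw [if_pos le_rfl, if_neg (by omega), Nat.sub_self] at this
        exact absurd this.symm nz2
    have hQ : altQ M * altQ N = altQ A * altQ B := by
      rw [h0] at h2
      exact mul_left_cancel₀ (pow_ne_zero _ Polynomial.X_ne_zero) h2
    rcases n with _ | m
    · refine Or.inl ⟨(A 0 : ℤ) - M 0, fun i => ?_⟩
      obtain rfl : i = 0 := by ext; simp
      constructor <;> omega
    · have hu : alt (m+1) (fun i => M i.succ) * alt (m+1) (fun i => N i.succ) =
          alt (m+1) (fun i => A i.succ) * alt (m+1) (fun i => B i.succ) := by
        have := congrArg (fun p => p.coeff 0) hQ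
        simpa only [Polynomial.mul_coeff_zero, altQ_coeff_zero _ hM, altQ_coeff_zero _ hN,
          altQ_coeff_zero _ hA, altQ_coeff_zero _ hB] using this
      have key : ∀ (A B : Fin (m + 2) → ℕ), StrictMono A → StrictMono B →
          M 0 + N 0 = A 0 + B 0 → altQ M * altQ N = altQ A * altQ B → ∀ c : ℤ,
          (∀ i : Fin (m + 1), (A i.succ : ℤ) = M i.succ + c ∧ (B i.succ : ℤ) = N i.succ - c) →
          PairRel M N A B := by
        intro A B hA hB h0 hQ c hc
        rcases le_total (M 1 - M 0) (N 1 - N 0) with hg | hg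
        · exact alt_core ih M N A B hM hN hA hB h0 hQ c hc hg
        · have := alt_core ih N M B A hN hM hB hA (by omega)
            (by rw [mul_comm, hQ, mul_comm]) (-c)
            (fun i => ⟨by have := hc i; omega, by have := hc i; omega⟩) hg
          exact this.swapL.swapR
      rcases ih _ _ _ _ (strictMono_comp_succ hM) (strictMono_comp_succ hN)
        (strictMono_comp_succ hA) (strictMono_comp_succ hB) hu with ⟨c, hc⟩ | ⟨c, hc⟩
      · exact key A B hA hB h0 hQ c hc
      · exact (key B A hB hA (by omega) (by rw [hQ, mul_comm]) (-c)
          (fun i => ⟨by have := hc i; dsimp only at this; omega, by have := hc i; dsimp only at this; omega⟩)).swapR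

/-! ### Gelfand–Tsetlin patterns -/

/-- Gelfand–Tsetlin patterns of skew shape `lam/mu` with `n` levels. -/
structure IsGT (n : ℕ) (lam mu : ℕ → ℕ) (G : ℕ → ℕ → ℕ) : Prop where
  zero : ∀ i, G 0 i = mu i
  top : ∀ k, n ≤ k → ∀ i, G k i = lam i
  mono : ∀ k i, G k i ≤ G (k + 1) i
  inter : ∀ k i, G (k + 1) (i + 1) ≤ G k i

lemma IsGT.monotone {n : ℕ} {lam mu : ℕ → ℕ} {G : ℕ → ℕ → ℕ} (h : IsGT n lam mu G) (i : ℕ) :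
    Monotone (fun k => G k i) := monotone_nat_of_le_succ fun k => h.mono k i

lemma IsGT.le_top {n : ℕ} {lam mu : ℕ → ℕ} {G : ℕ → ℕ → ℕ} (h : IsGT n lam mu G) (k i : ℕ) :
    G k i ≤ lam i := by
  rw [← h.top (max n k) (le_max_left _ _) i]
  exact h.monotone i (le_max_right _ _)

lemma IsGT.antitone {n : ℕ} {lam mu : ℕ → ℕ} {G : ℕ → ℕ → ℕ} (h : IsGT n lam mu G) (k : ℕ) :
    Antitone (G k) := antitone_nat_of_succ_le fun i => (h.mono k (i+1)).trans (h.inter k i)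

lemma gt_finite (n l : ℕ) (lam mu : ℕ → ℕ) (hl : ∀ i, l ≤ i → lam i = 0) :
    {G | IsGT n lam mu G}.Finite := by
  let F : (ℕ → ℕ → ℕ) → (Fin (n + 1) → Fin l → ℕ) := fun G k i => G k i
  have hfin : (Set.univ.pi fun _ : Fin (n + 1) => Set.univ.pi fun i : Fin l =>
      Set.Iic (lam i)).Finite :=
    Set.Finite.pi fun _ => Set.Finite.pi fun i => Set.finite_Iic _
  refine Set.Finite.of_finite_image (f := F) (hfin.subset ?_) ?_
  · rintro _ ⟨G, hG, rfl⟩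
    simp only [Set.mem_pi, Set.mem_univ, forall_true_left, Set.mem_Iic]
    intro k i
    exact IsGT.le_top hG k i
  · intro G hG G' hG' h
    funext k i
    by_cases hi : i < l
    · by_cases hk : k < n + 1
      · exact congrFun (congrFun h ⟨k, hk⟩) ⟨i, hi⟩
      · rw [hG.top k (by omega), hG'.top k (by omega)]
    · have h1 := IsGT.le_top hG k i
      have h2 := IsGT.le_top hG' k i
      rw [hl i (by omega)] at h1 h2
      omega

/-- The weight of a pattern. -/
def wt (l : ℕ) (G : ℕ → ℕ → ℕ) (k : ℕ) : ℕ := ∑ i ∈ Finset.range l, (G (k + 1) i - G k i)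

/-- Partial row sums. -/
def PS (G : ℕ → ℕ → ℕ) (k i : ℕ) : ℕ := ∑ t ∈ Finset.range i, G k t

lemma PS_succ (G : ℕ → ℕ → ℕ) (k i : ℕ) : PS G k (i + 1) = PS G k i + G k i := by
  simp [PS, Finset.sum_range_succ]

lemma PS_zero (G : ℕ → ℕ → ℕ) (k : ℕ) : PS G k 0 = 0 := by simp [PS]

lemma IsGT.wt_add {n : ℕ} {lam mu : ℕ → ℕ} {G : ℕ → ℕ → ℕ} (h : IsGT n lam mu G) (l k : ℕ) :
    PS G (k + 1) l = PS G k l + wt l G k := by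
  unfold PS wt
  rw [← Finset.sum_add_distrib]
  refine Finset.sum_congr rfl fun i _ => ?_
  have := h.mono k i
  omega

lemma IsGT.mono2 {n : ℕ} {lam mu : ℕ → ℕ} {G : ℕ → ℕ → ℕ} (h : IsGT n lam mu G) (k i : ℕ) :
    G (k + 1) i ≤ G (k + 2) i := h.mono (k + 1) i

lemma IsGT.inter2 {n : ℕ} {lam mu : ℕ → ℕ} {G : ℕ → ℕ → ℕ} (h : IsGT n lam mu G) (k i : ℕ) :
    G (k + 2) (i + 1) ≤ G (k + 1) i := h.inter (k + 1) i

lemma IsGT.wt_add2 {n : ℕ} {lam mu : ℕ → ℕ} {G : ℕ → ℕ → ℕ} (h : IsGT n lam mu G) (l k : ℕ) :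
    PS G (k + 2) l = PS G (k + 1) l + wt l G (k + 1) := h.wt_add l (k + 1)

/-- The violation of the lattice condition. -/
def Bad (G : ℕ → ℕ → ℕ) (i k : ℕ) : Prop :=
  PS G (k + 1) (i + 1) + PS G (k + 1) i < PS G (k + 2) (i + 1) + PS G k i

/-- The lattice condition. -/
def Good (G : ℕ → ℕ → ℕ) : Prop := ∀ i k, ¬ Bad G i k

/-- The (partial) Bender–Knuth reflection. -/
def refl (k i0 J : ℕ) (G : ℕ → ℕ → ℕ) : ℕ → ℕ → ℕ := fun k' i =>
  if k' = k + 1 then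
    (if i < i0 then G (k + 1) i
     else if i = i0 then max (G k i) (G (k + 2) (i + 1)) + J - G (k + 1) i
     else max (G k i) (G (k + 2) (i + 1)) + min (G (k + 2) i) (G k (i - 1)) - G (k + 1) i)
  else G k' i

lemma refl_ne (k i0 J : ℕ) (G : ℕ → ℕ → ℕ) (k' i : ℕ) (h : k' ≠ k + 1) :
    refl k i0 J G k' i = G k' i := by simp [refl, h]

lemma refl_lt (k i0 J : ℕ) (G : ℕ → ℕ → ℕ) (i : ℕ) (h : i < i0) :
    refl k i0 J G (k + 1) i = G (k + 1) i := by simp [refl, h]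

lemma refl_eq (k i0 J : ℕ) (G : ℕ → ℕ → ℕ) :
    refl k i0 J G (k + 1) i0 = max (G k i0) (G (k + 2) (i0 + 1)) + J - G (k + 1) i0 := by
  simp [refl]

lemma refl_gt (k i0 J : ℕ) (G : ℕ → ℕ → ℕ) (i : ℕ) (h : i0 < i) :
    refl k i0 J G (k + 1) i = max (G k i) (G (k + 2) (i + 1)) +
      min (G (k + 2) i) (G k (i - 1)) - G (k + 1) i := by
  simp [refl, show ¬ i < i0 by omega, show i ≠ i0 by omega]

/-- Conditions for a reflection to be legal. -/
structure ReflOK (n k i0 J : ℕ) (G : ℕ → ℕ → ℕ) : Prop where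
  hk : k + 2 ≤ n
  h1 : G (k + 1) i0 ≤ J
  h2 : J ≤ G (k + 2) i0
  h3 : 0 < i0 → J ≤ G k (i0 - 1)

section
variable {n : ℕ} {lam mu : ℕ → ℕ} {G : ℕ → ℕ → ℕ} {k i0 J : ℕ}

lemma refl_bounds (h : IsGT n lam mu G) (hr : ReflOK n k i0 J G) (i : ℕ) :
    G k i ≤ refl k i0 J G (k + 1) i ∧ refl k i0 J G (k + 1) i ≤ G (k + 2) i ∧
    G (k + 2) (i + 1) ≤ refl k i0 J G (k + 1) i ∧
    (0 < i → refl k i0 J G (k + 1) i ≤ G k (i - 1)) := by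
  have a1 := h.mono k i
  have a2 := h.mono2 k i
  have a3 := h.inter2 k i
  have a4 : 0 < i → G (k + 1) i ≤ G k (i - 1) := by
    intro hi
    have := h.inter k (i - 1)
    rwa [Nat.sub_add_cancel hi] at this
  obtain ⟨_, h1, h2, h3⟩ := hr
  rcases lt_trichotomy i i0 with hi | hi | hi
  · rw [refl_lt _ _ _ _ _ hi]; exact ⟨a1, a2, a3, a4⟩
  · subst hi
    rw [refl_eq]
    rcases Nat.eq_zero_or_pos i with hi | hi
    · refine ⟨?_, ?_, ?_, ?_⟩ <;> omega
    · have := a4 hi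
      have := h3 hi
      refine ⟨?_, ?_, ?_, ?_⟩ <;> omega
  · rw [refl_gt _ _ _ _ _ hi]
    have := a4 (by omega)
    refine ⟨?_, ?_, ?_, ?_⟩ <;> omega

lemma refl_isGT (h : IsGT n lam mu G) (hr : ReflOK n k i0 J G) :
    IsGT n lam mu (refl k i0 J G) := by
  have hk := hr.hk
  have hb := refl_bounds h hr
  refine ⟨fun i => ?_, fun k' hk' i => ?_, fun k' i => ?_, fun k' i => ?_⟩
  · rw [refl_ne _ _ _ _ _ _ (by omega)]; exact h.zero i
  · rw [refl_ne _ _ _ _ _ _ (by omega)]; exact h.top k' hk' i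
  · by_cases e1 : k' = k + 1
    · subst e1
      rw [refl_ne _ _ _ _ (k + 1 + 1) _ (by omega)]
      exact (hb i).2.1
    · by_cases e2 : k' = k
      · subst e2
        rw [refl_ne _ _ _ _ _ _ e1]
        exact (hb i).1
      · rw [refl_ne _ _ _ _ _ _ e1, refl_ne _ _ _ _ _ _ (by omega)]
        exact h.mono k' i
  · by_cases e1 : k' = k + 1
    · subst e1
      rw [refl_ne _ _ _ _ (k + 1 + 1) _ (by omega)]
      exact (hb i).2.2.1
    · by_cases e2 : k' = k
      · subst e2
        rw [refl_ne _ _ _ _ _ _ e1]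
        have := (hb (i + 1)).2.2.2 (by omega)
        simpa using this
      · rw [refl_ne _ _ _ _ _ _ e1, refl_ne _ _ _ _ _ _ (by omega)]
        exact h.inter k' i

lemma refl_OK (h : IsGT n lam mu G) (hr : ReflOK n k i0 J G) :
    ReflOK n k i0 J (refl k i0 J G) := by
  refine ⟨hr.hk, ?_, ?_, ?_⟩
  · rw [refl_eq]
    have a1 := h.mono k i0
    have a3 := h.inter2 k i0
    omega
  · rw [refl_ne _ _ _ _ _ _ (by omega)]; exact hr.h2
  · rw [refl_ne _ _ _ _ _ _ (by omega)]; exact hr.h3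

lemma refl_refl (h : IsGT n lam mu G) (hr : ReflOK n k i0 J G) :
    refl k i0 J (refl k i0 J G) = G := by
  funext k' i
  by_cases e1 : k' = k + 1
  · subst e1
    have a1 := h.mono k i
    have a2 := h.mono2 k i
    have a3 := h.inter2 k i
    have a4 : 0 < i → G (k + 1) i ≤ G k (i - 1) := by
      intro hi
      have := h.inter k (i - 1)
      rwa [Nat.sub_add_cancel hi] at this
    obtain ⟨_, h1, h2, h3⟩ := hr
    rcases lt_trichotomy i i0 with hi | hi | hi
    · rw [refl_lt _ _ _ _ _ hi, refl_lt _ _ _ _ _ hi]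
    · subst hi
      rw [refl_eq, refl_eq, refl_ne _ _ _ _ _ _ (by omega), refl_ne _ _ _ _ _ _ (by omega)]
      omega
    · have := a4 (by omega)
      rw [refl_gt _ _ _ _ _ hi, refl_gt _ _ _ _ _ hi]
      simp only [refl_ne _ _ _ _ _ _ (show k ≠ k + 1 by omega),
        refl_ne _ _ _ _ _ _ (show k + 2 ≠ k + 1 by omega)]
      omega
  · rw [refl_ne _ _ _ _ _ _ e1, refl_ne _ _ _ _ _ _ e1]

lemma PS_refl_ne (k' i : ℕ) (h : k' ≠ k + 1) : PS (refl k i0 J G) k' i = PS G k' i := by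
  simp [PS, refl_ne _ _ _ _ _ _ h]

lemma PS_refl_le (k' i : ℕ) (h : i ≤ i0) : PS (refl k i0 J G) k' i = PS G k' i := by
  by_cases e : k' = k + 1
  · subst e
    refine Finset.sum_congr rfl fun t ht => ?_
    rw [refl_lt]
    have := Finset.mem_range.1 ht
    omega
  · exact PS_refl_ne _ _ e

lemma PS_refl_gt (h : IsGT n lam mu G) (hr : ReflOK n k i0 J G) (m : ℕ) :
    PS (refl k i0 J G) (k + 1) (i0 + m + 1) + PS G (k + 1) (i0 + m + 1) +
      min (G (k + 2) (i0 + m + 1)) (G k (i0 + m)) + PS G k i0 + PS G (k + 2) (i0 + 1) =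
    2 * PS G (k + 1) i0 + J + PS G k (i0 + m + 1) + PS G (k + 2) (i0 + m + 2) := by
  induction m with
  | zero =>
    have a1 := h.mono k i0
    have a3 := h.inter2 k i0
    have h1 := hr.h1
    simp only [add_zero, PS_succ, PS_refl_le _ _ (le_refl i0), refl_eq]
    omega
  | succ m ih =>
    have a1 := h.mono k (i0 + m + 1)
    have a2 := h.mono2 k (i0 + m + 1)
    have a3 := h.inter2 k (i0 + m + 1)
    have a4 := h.inter k (i0 + m)
    have := refl_gt k i0 J G (i0 + m + 1) (by omega)
    simp only [Nat.add_sub_cancel] at this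
    rw [show i0 + (m + 1) = i0 + m + 1 by omega]
    have b1 := PS_succ (refl k i0 J G) (k + 1) (i0 + m + 1)
    have b2 := PS_succ G (k + 1) (i0 + m + 1)
    have b3 := PS_succ G k (i0 + m + 1)
    have b4 := PS_succ G (k + 2) (i0 + m + 2)
    simp only [add_assoc, Nat.reduceAdd] at *
    omega

lemma PS_refl_total {l : ℕ} (hl : ∀ i, l ≤ i → lam i = 0) (h : IsGT n lam mu G)
    (hr : ReflOK n k i0 J G) (hi : i0 < l) :
    PS (refl k i0 J G) (k + 1) l + PS G (k + 1) l + PS G k i0 + PS G (k + 2) (i0 + 1) =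
    2 * PS G (k + 1) i0 + J + PS G k l + PS G (k + 2) l := by
  obtain ⟨m, rfl⟩ : ∃ m, l = i0 + m + 1 := ⟨l - i0 - 1, by omega⟩
  have h1 := PS_refl_gt h hr m
  have h2 : G (k + 2) (i0 + m + 1) = 0 := by
    have := h.le_top (k + 2) (i0 + m + 1)
    rw [hl _ le_rfl] at this; omega
  rw [PS_succ G (k + 2) (i0 + m + 1), h2] at h1
  omega

lemma wt_refl_ne (l k' : ℕ) (h1 : k' ≠ k) (h2 : k' ≠ k + 1) :
    wt l (refl k i0 J G) k' = wt l G k' := by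
  refine Finset.sum_congr rfl fun i _ => ?_
  rw [refl_ne _ _ _ _ _ _ (by omega), refl_ne _ _ _ _ _ _ (by omega)]

/-- Full Bender–Knuth reflection. -/
lemma full_OK (h : IsGT n lam mu G) (hk : k + 2 ≤ n) : ReflOK n k 0 (G (k + 2) 0) G :=
  ⟨hk, h.mono _ _, le_rfl, fun h => absurd h (lt_irrefl _)⟩

lemma wt_full {l : ℕ} (hl : ∀ i, l ≤ i → lam i = 0) (hl0 : 0 < l) (h : IsGT n lam mu G)
    (hk : k + 2 ≤ n) :
    wt l (refl k 0 (G (k + 2) 0) G) k = wt l G (k + 1) ∧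
    wt l (refl k 0 (G (k + 2) 0) G) (k + 1) = wt l G k := by
  have hr := full_OK h hk
  have h' := refl_isGT h hr
  have t := PS_refl_total hl h hr hl0
  have e1 := h'.wt_add l k
  have e2 := h'.wt_add2 l k
  have e3 := h.wt_add l k
  have e4 := h.wt_add2 l k
  rw [PS_refl_ne k _ (by omega)] at e1
  rw [PS_refl_ne (k + 2) _ (by omega)] at e2
  simp only [PS_succ, PS_zero] at t
  constructor <;> omega

/-- The first violation of the lattice condition. -/
structure FirstBad (G : ℕ → ℕ → ℕ) (i k : ℕ) : Prop where
  bad : Bad G i k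
  rows : ∀ i' < i, ∀ k', ¬ Bad G i' k'
  lev : ∀ k', k < k' → ¬ Bad G i k'

lemma FirstBad.unique {i k i' k' : ℕ} (h : FirstBad G i k) (h' : FirstBad G i' k') :
    i = i' ∧ k = k' := by
  have hi : i = i' := by
    rcases lt_trichotomy i i' with hl | hl | hl
    · exact absurd h.bad (h'.rows i hl k)
    · exact hl
    · exact absurd h'.bad (h.rows i' hl k')
  subst hi
  refine ⟨rfl, ?_⟩
  rcases lt_trichotomy k k' with hl | hl | hl
  · exact absurd h'.bad (h.lev k' hl)
  · exact hl
  · exact absurd h.bad (h'.lev k hl)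

lemma Bad.lev_lt (h : IsGT n lam mu G) {i k : ℕ} (hb : Bad G i k) : k + 2 ≤ n := by
  by_contra hcon
  unfold Bad at hb
  have e1 : ∀ i, PS G (k + 2) i = PS G (k + 1) i := fun i =>
    Finset.sum_congr rfl fun t _ => by rw [h.top _ (by omega), h.top _ (by omega)]
  have e2 : PS G k i ≤ PS G (k + 1) i := Finset.sum_le_sum fun t _ => h.mono k t
  rw [e1] at hb
  omega

lemma exists_firstBad (h : IsGT n lam mu G) (hb : ¬ Good G) : ∃ i k, FirstBad G i k := by
  have hex : ∃ i, ∃ k, Bad G i k := by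
    unfold Good at hb; push Not at hb; exact hb
  obtain ⟨k0, hk0⟩ := Nat.find_spec hex
  refine ⟨Nat.find hex, Nat.findGreatest (fun k => Bad G (Nat.find hex) k) n, ?_, ?_, ?_⟩
  · exact Nat.findGreatest_spec (P := fun k => Bad G (Nat.find hex) k)
      (by have := hk0.lev_lt h; omega) hk0
  · intro i' hi' k' hb'
    exact Nat.find_min hex hi' ⟨k', hb'⟩
  · intro k' hk' hb'
    exact Nat.findGreatest_is_greatest hk' (by have := hb'.lev_lt h; omega) hb'

/-- The column where the violation occurs. -/
def badJ (G : ℕ → ℕ → ℕ) (i k : ℕ) : ℕ :=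
  PS G (k + 2) (i + 1) + PS G k i - 2 * PS G (k + 1) i - 1

lemma FirstBad.J_eq {i k : ℕ} (hb : FirstBad G i k) :
    badJ G i k + 1 + 2 * PS G (k + 1) i = PS G (k + 2) (i + 1) + PS G k i := by
  have := hb.bad
  unfold Bad at this
  unfold badJ
  rw [PS_succ G (k + 1)] at this
  omega

lemma FirstBad.J_lt (h : IsGT n lam mu G) {i k : ℕ} (hb : FirstBad G i k) :
    badJ G i k + 1 ≤ G (k + 2) i ∧ (0 < i → badJ G i k + 1 ≤ G k (i - 1)) := by
  have e := hb.J_eq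
  rcases Nat.eq_zero_or_pos i with rfl | hi
  · simp only [PS_succ, PS_zero] at e
    exact ⟨by omega, fun h => absurd h (lt_irrefl _)⟩
  · obtain ⟨i, rfl⟩ : ∃ i', i = i' + 1 := ⟨i - 1, by omega⟩
    have hn := hb.rows i (by omega) k
    unfold Bad at hn
    have a1 := h.inter2 k i
    have a2 := h.mono k i
    simp only [PS_succ] at e hn
    simp only [Nat.add_sub_cancel]
    constructor
    · omega
    · intro _; omega

lemma FirstBad.reflOK (h : IsGT n lam mu G) {i k : ℕ} (hb : FirstBad G i k) :
    ReflOK n k i (badJ G i k) G := by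
  obtain ⟨j1, j2⟩ := hb.J_lt h
  refine ⟨hb.bad.lev_lt h, ?_, by omega, fun hi => by have := j2 hi; omega⟩
  have e := hb.J_eq
  have := hb.bad
  unfold Bad at this
  rw [PS_succ G (k + 1)] at this
  omega

lemma FirstBad.badJ_refl {i k : ℕ} : badJ (refl k i (badJ G i k) G) i k = badJ G i k := by
  unfold badJ
  rw [PS_refl_ne _ _ (by omega), PS_refl_le _ _ le_rfl, PS_refl_le _ _ le_rfl]

lemma FirstBad.refl (h : IsGT n lam mu G) {i k : ℕ} (hb : FirstBad G i k) :
    FirstBad (refl k i (badJ G i k) G) i k := by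
  have hr := hb.reflOK h
  refine ⟨?_, fun i' hi' k' hbad => ?_, fun k' hk' hbad => ?_⟩
  · have := (refl_OK h hr).h1
    have e := hb.J_eq
    unfold Bad
    rw [PS_succ _ (k + 1), PS_refl_le _ _ le_rfl, PS_refl_ne _ _ (by omega),
      PS_refl_le _ _ le_rfl]
    omega
  · refine hb.rows i' hi' k' ?_
    unfold Bad at hbad ⊢
    simpa only [PS_refl_le _ _ (show i' + 1 ≤ i by omega),
      PS_refl_le _ _ (show i' ≤ i by omega)] using hbad
  · refine hb.lev k' hk' ?_
    unfold Bad at hbad ⊢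
    simpa only [PS_refl_le _ _ (le_refl i), PS_refl_ne _ _ (show k' + 1 ≠ k + 1 by omega),
      PS_refl_ne _ _ (show k' + 2 ≠ k + 1 by omega)] using hbad

lemma FirstBad.wt {l : ℕ} (hl : ∀ i, l ≤ i → lam i = 0) (h : IsGT n lam mu G) {i k : ℕ}
    (hb : FirstBad G i k) :
    wt l (LRSkew.refl k i (badJ G i k) G) k + 1 = wt l G (k + 1) ∧
    wt l (LRSkew.refl k i (badJ G i k) G) (k + 1) = wt l G k + 1 := by
  have hr := hb.reflOK h
  have h' := refl_isGT h hr
  have hil : i < l := by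
    by_contra hcon
    have h1 := (hb.J_lt h).1
    have h2 := h.le_top (k + 2) i
    rw [hl i (by omega)] at h2
    omega
  have t := PS_refl_total hl h hr hil
  have e1 := h'.wt_add l k
  have e2 := h'.wt_add2 l k
  have e3 := h.wt_add l k
  have e4 := h.wt_add2 l k
  have e5 := hb.J_eq
  rw [PS_refl_ne k _ (by omega)] at e1
  rw [PS_refl_ne (k + 2) _ (by omega)] at e2
  constructor <;> omega

end

/-- The sign-reversing involution on bad patterns. -/
noncomputable def invol (G : ℕ → ℕ → ℕ) : ℕ → ℕ → ℕ :=
  if h : ∃ p : ℕ × ℕ, FirstBad G p.1 p.2 then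
    refl h.choose.2 h.choose.1 (badJ G h.choose.1 h.choose.2) G else G

lemma invol_eq {G : ℕ → ℕ → ℕ} {i k : ℕ} (hb : FirstBad G i k) :
    invol G = refl k i (badJ G i k) G := by
  have h : ∃ p : ℕ × ℕ, FirstBad G p.1 p.2 := ⟨(i, k), hb⟩
  unfold invol
  rw [dif_pos h]
  obtain ⟨e1, e2⟩ := h.choose_spec.unique hb
  rw [e1, e2]

/-- Finset of patterns. -/
noncomputable def gts (n l : ℕ) (lam mu : ℕ → ℕ) (hl : ∀ i, l ≤ i → lam i = 0) :
    Finset (ℕ → ℕ → ℕ) := (gt_finite n l lam mu hl).toFinset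

lemma mem_gts {n l : ℕ} {lam mu : ℕ → ℕ} {hl : ∀ i, l ≤ i → lam i = 0} {G : ℕ → ℕ → ℕ} :
    G ∈ gts n l lam mu hl ↔ IsGT n lam mu G := by simp [gts]

/-- The generating function of patterns (the skew Schur polynomial). -/
noncomputable def sch (n l : ℕ) (lam mu : ℕ → ℕ) (hl : ∀ i, l ≤ i → lam i = 0) :
    MvPolynomial (Fin n) ℤ :=
  ∑ G ∈ gts n l lam mu hl, ∏ k : Fin n, MvPolynomial.X k ^ wt l G k

lemma sch_swap (n l : ℕ) (lam mu : ℕ → ℕ) (hl : ∀ i, l ≤ i → lam i = 0) (hl0 : 0 < l)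
    (k : ℕ) (hk : k + 2 ≤ n) :
    MvPolynomial.rename (Equiv.swap (⟨k, by omega⟩ : Fin n) ⟨k + 1, by omega⟩)
      (sch n l lam mu hl) = sch n l lam mu hl := by
  unfold sch
  rw [map_sum]
  refine Finset.sum_nbij' (fun G => refl k 0 (G (k + 2) 0) G) (fun G => refl k 0 (G (k + 2) 0) G)
    ?_ ?_ ?_ ?_ ?_
  · intro G hG
    rw [mem_gts] at hG ⊢
    exact refl_isGT hG (full_OK hG hk)
  · intro G hG
    rw [mem_gts] at hG ⊢
    exact refl_isGT hG (full_OK hG hk)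
  · intro G hG
    rw [mem_gts] at hG
    simp only [refl_ne _ _ _ _ _ _ (show k + 2 ≠ k + 1 by omega)]
    exact refl_refl hG (full_OK hG hk)
  · intro G hG
    rw [mem_gts] at hG
    simp only [refl_ne _ _ _ _ _ _ (show k + 2 ≠ k + 1 by omega)]
    exact refl_refl hG (full_OK hG hk)
  · intro G hG
    rw [mem_gts] at hG
    rw [map_prod]
    simp only [map_pow, MvPolynomial.rename_X]
    rw [← Equiv.prod_comp (Equiv.swap (⟨k, by omega⟩ : Fin n) ⟨k + 1, by omega⟩)]
    refine Finset.prod_congr rfl fun j _ => ?_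
    rw [Equiv.swap_apply_self]
    congr 1
    obtain ⟨w1, w2⟩ := wt_full hl hl0 hG hk
    by_cases j1 : j = ⟨k, by omega⟩
    · subst j1; rw [Equiv.swap_apply_left]; exact w1.symm
    · by_cases j2 : j = ⟨k + 1, by omega⟩
      · subst j2; rw [Equiv.swap_apply_right]; exact w2.symm
      · rw [Equiv.swap_apply_of_ne_of_ne j1 j2, wt_refl_ne]
        · exact fun h => j1 (Fin.ext h)
        · exact fun h => j2 (Fin.ext h)

lemma sch_symm (n l : ℕ) (lam mu : ℕ → ℕ) (hl : ∀ i, l ≤ i → lam i = 0) (hl0 : 0 < l)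
    (σ : Equiv.Perm (Fin n)) :
    MvPolynomial.rename σ (sch n l lam mu hl) = sch n l lam mu hl := by
  rcases n with _ | n
  · rw [Subsingleton.elim σ 1]
    simp
  have hσ : σ ∈ Submonoid.closure (Set.range fun i : Fin n => Equiv.swap i.castSucc i.succ) := by
    rw [Equiv.Perm.mclosure_swap_castSucc_succ]; trivial
  induction hσ using Submonoid.closure_induction with
  | mem x hx =>
    obtain ⟨i, rfl⟩ := hx
    exact sch_swap (n + 1) l lam mu hl hl0 i (by omega)
  | one => simp
  | mul x y _ _ hx hy =>
    rw [Equiv.Perm.coe_mul, ← MvPolynomial.rename_rename, hy, hx]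

lemma alt_perm (n : ℕ) (e : Fin n → ℕ) (σ : Equiv.Perm (Fin n)) :
    alt n (fun i => e (σ i)) = (Equiv.Perm.sign σ : ℤ) * alt n e := by
  unfold alt
  rw [← Matrix.det_permute']
  rfl

lemma alt_mul_sch (n l : ℕ) (lam mu : ℕ → ℕ) (hl : ∀ i, l ≤ i → lam i = 0) (hl0 : 0 < l)
    (d : Fin n → ℕ) :
    alt n d * sch n l lam mu hl = ∑ G ∈ gts n l lam mu hl, alt n (fun k => d k + wt l G k) := by
  unfold alt
  simp only [Matrix.det_apply', Matrix.of_apply]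
  rw [Finset.sum_mul, Finset.sum_comm]
  refine Finset.sum_congr rfl fun σ _ => ?_
  rw [← sch_symm n l lam mu hl hl0 σ]
  unfold sch
  rw [map_sum, Finset.mul_sum]
  refine Finset.sum_congr rfl fun G _ => ?_
  rw [map_prod]
  simp only [map_pow, MvPolynomial.rename_X, pow_add, Finset.prod_mul_distrib]
  ring

/-- Good patterns. -/
noncomputable def ggts (n l : ℕ) (lam mu : ℕ → ℕ) (hl : ∀ i, l ≤ i → lam i = 0) :
    Finset (ℕ → ℕ → ℕ) := (gts n l lam mu hl).filter Good

/-- The exponent vector. -/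
def dl (n : ℕ) (f : ℕ → ℕ) : Fin n → ℕ := fun k => (n - 1 - k) + f k

theorem alt_mul_sch_good (n l : ℕ) (lam mu : ℕ → ℕ) (hl : ∀ i, l ≤ i → lam i = 0) (hl0 : 0 < l) :
    alt n (dl n fun _ => 0) * sch n l lam mu hl =
      ∑ G ∈ ggts n l lam mu hl, alt n (dl n (wt l G)) := by
  rw [alt_mul_sch n l lam mu hl hl0]
  have e0 : ∀ G : ℕ → ℕ → ℕ, alt n (fun k => dl n (fun _ => 0) k + wt l G k)
      = alt n (dl n (wt l G)) := fun G => rfl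
  simp only [e0]
  unfold ggts
  rw [← Finset.sum_filter_add_sum_filter_not (gts n l lam mu hl) Good]
  conv_rhs => rw [← add_zero (Finset.sum _ _)]
  congr 1
  have key : ∀ G ∈ (gts n l lam mu hl).filter (fun G => ¬ Good G), ∃ i k, IsGT n lam mu G ∧
      FirstBad G i k := by
    intro G hG
    rw [Finset.mem_filter, mem_gts] at hG
    obtain ⟨i, k, h⟩ := exists_firstBad hG.1 hG.2
    exact ⟨i, k, hG.1, h⟩
  have key2 : ∀ G i k, IsGT n lam mu G → FirstBad G i k →
      alt n (dl n (wt l (invol G))) = - alt n (dl n (wt l G)) := by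
    intro G i k h hb
    rw [invol_eq hb]
    have hk := hb.bad.lev_lt h
    obtain ⟨w1, w2⟩ := hb.wt hl h
    have : dl n (wt l (refl k i (badJ G i k) G)) = fun j => dl n (wt l G)
        (Equiv.swap (⟨k, by omega⟩ : Fin n) ⟨k + 1, by omega⟩ j) := by
      funext j
      by_cases j1 : j = ⟨k, by omega⟩
      · subst j1; rw [Equiv.swap_apply_left]; simp only [dl]; omega
      · by_cases j2 : j = ⟨k + 1, by omega⟩
        · subst j2; rw [Equiv.swap_apply_right]; simp only [dl]; omega
        · rw [Equiv.swap_apply_of_ne_of_ne j1 j2]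
          simp only [dl]
          rw [wt_refl_ne]
          · exact fun h => j1 (Fin.ext h)
          · exact fun h => j2 (Fin.ext h)
    rw [this, alt_perm, Equiv.Perm.sign_swap]
    · simp
    · intro h; simp [Fin.ext_iff] at h
  refine Finset.sum_involution (fun G _ => invol G) ?_ ?_ ?_ ?_
  · intro G hG
    obtain ⟨i, k, h, hb⟩ := key G hG
    rw [key2 G i k h hb]; ring
  · intro G hG hne heq
    obtain ⟨i, k, h, hb⟩ := key G hG
    have := key2 G i k h hb
    rw [heq] at this
    exact hne (self_eq_neg.1 this)
  · intro G hG
    obtain ⟨i, k, h, hb⟩ := key G hG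
    rw [invol_eq hb, Finset.mem_filter, mem_gts]
    refine ⟨refl_isGT h (hb.reflOK h), fun hg => hg i k (hb.refl h).bad⟩
  · intro G hG
    obtain ⟨i, k, h, hb⟩ := key G hG
    simp only [invol_eq hb]
    rw [invol_eq (hb.refl h), FirstBad.badJ_refl]
    exact refl_refl h (hb.reflOK h)

/-! ### Straight shapes -/

/-- The unique good pattern of straight shape. -/
def strG (κ : ℕ → ℕ) : ℕ → ℕ → ℕ := fun k i => if i < k then κ i else 0

lemma strG_isGT {l : ℕ} {κ : ℕ → ℕ} (hl : ∀ i, l ≤ i → κ i = 0) (ha : Antitone κ) :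
    IsGT l κ (fun _ => 0) (strG κ) := by
  refine ⟨fun i => by simp [strG], fun k hk i => ?_, fun k i => ?_, fun k i => ?_⟩
  · unfold strG
    split_ifs with h
    · rfl
    · exact (hl i (by omega)).symm
  · unfold strG
    split_ifs <;> omega
  · unfold strG
    have := ha (Nat.le_succ i)
    split_ifs <;> first | omega | exact this

lemma PS_strG (κ : ℕ → ℕ) (k i : ℕ) :
    PS (strG κ) k i = ∑ t ∈ Finset.range (min k i), κ t := by
  unfold PS strG
  rw [← Finset.sum_filter]
  congr 1
  ext t
  simp only [Finset.mem_filter, Finset.mem_range]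
  omega

lemma strG_good {κ : ℕ → ℕ} (ha : Antitone κ) : Good (strG κ) := by
  intro i k hb
  unfold Bad at hb
  simp only [PS_strG] at hb
  rcases Nat.lt_or_ge k i with h | h
  · rw [show min (k + 1) (i + 1) = k + 1 by omega, show min (k + 1) i = k + 1 by omega,
      show min (k + 2) (i + 1) = k + 2 by omega, show min k i = k by omega,
      Finset.sum_range_succ _ (k + 1), Finset.sum_range_succ _ k] at hb
    have := ha (Nat.le_succ k)
    simp only [Nat.succ_eq_add_one] at this
    omega
  · rw [show min (k + 1) (i + 1) = i + 1 by omega, show min (k + 1) i = i by omega,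
      show min (k + 2) (i + 1) = i + 1 by omega, show min k i = i by omega] at hb
    omega

lemma straight_zero {n : ℕ} {κ : ℕ → ℕ} {G : ℕ → ℕ → ℕ} (h : IsGT n κ (fun _ => 0) G) :
    ∀ k i, k ≤ i → G k i = 0 := by
  intro k
  induction k with
  | zero => intro i _; exact h.zero i
  | succ k ih =>
    intro i hi
    obtain ⟨i, rfl⟩ : ∃ i', i = i' + 1 := ⟨i - 1, by omega⟩
    have := h.inter k i
    rw [ih i (by omega)] at this
    omega

lemma straight_unique {n : ℕ} {κ : ℕ → ℕ} {G : ℕ → ℕ → ℕ} (h : IsGT n κ (fun _ => 0) G)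
    (hg : Good G) : G = strG κ := by
  have key : ∀ i, ∀ k, i < k → G k i = κ i := by
    intro i
    induction i using Nat.strong_induction_on with
    | _ i ih =>
      have step : ∀ k, i + 1 ≤ k → G (k + 1) i = G k i := by
        intro k hk
        obtain ⟨k, rfl⟩ : ∃ k', k = k' + 1 := ⟨k - 1, by omega⟩
        have hb := hg i k
        unfold Bad at hb
        have e : ∀ k', i ≤ k' → PS G k' i = ∑ t ∈ Finset.range i, κ t := by
          intro k' hk'
          refine Finset.sum_congr rfl fun t ht => ?_
          have := Finset.mem_range.1 ht
          exact ih t this k' (by omega)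
        rw [PS_succ, PS_succ, e _ (by omega), e _ (by omega), e _ (by omega)] at hb
        have := h.mono2 k i
        change G (k + 2) i = G (k + 1) i
        omega
      intro k hk
      have cst : ∀ m, G (k + m) i = G k i := by
        intro m
        induction m with
        | zero => rfl
        | succ m ihm => rw [← ihm]; exact step (k + m) (by omega)
      rw [← cst n, h.top _ (by omega)]
  funext k i
  unfold strG
  split_ifs with hi
  · exact key i k hi
  · exact straight_zero h k i (by omega)

lemma wt_strG {l : ℕ} (κ : ℕ → ℕ) (k : ℕ) (hk : k < l) : wt l (strG κ) k = κ k := by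
  unfold wt strG
  rw [Finset.sum_eq_single k]
  · simp
  · intro b _ hb
    split_ifs <;> omega
  · intro h; exact absurd (Finset.mem_range.2 hk) h

lemma alt_mul_sch_straight (l : ℕ) (κ : ℕ → ℕ) (hl : ∀ i, l ≤ i → κ i = 0) (hl0 : 0 < l)
    (ha : Antitone κ) :
    alt l (dl l fun _ => 0) * sch l l κ (fun _ => 0) hl = alt l (dl l κ) := by
  rw [alt_mul_sch_good _ _ _ _ _ hl0]
  have : ggts l l κ (fun _ => 0) hl = {strG κ} := by
    ext G
    unfold ggts
    rw [Finset.mem_filter, mem_gts, Finset.mem_singleton]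
    constructor
    · rintro ⟨h, hg⟩; exact straight_unique h hg
    · rintro rfl; exact ⟨strG_isGT hl ha, strG_good ha⟩
  rw [this, Finset.sum_singleton]
  congr 1
  funext k
  simp only [dl]
  rw [wt_strG _ _ k.2]

/-! ### Factorization in `l` variables -/

section
variable {l J : ℕ} {lam mu : ℕ → ℕ}

/-- First factor. -/
def k1 (J : ℕ) (lam : ℕ → ℕ) : ℕ → ℕ := fun i => lam i - J
/-- Second factor. -/
def k2 (l J : ℕ) (mu : ℕ → ℕ) : ℕ → ℕ := fun i => if i < l then J - mu (l - 1 - i) else 0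

lemma k1_zero (hl : ∀ i, l ≤ i → lam i = 0) : ∀ i, l ≤ i → k1 J lam i = 0 := by
  intro i hi; simp [k1, hl i hi]

lemma k2_zero : ∀ i, l ≤ i → k2 l J mu i = 0 := by
  intro i hi; simp [k2, not_lt.2 hi]

lemma k1_anti (h : Antitone lam) : Antitone (k1 J lam) := fun a b hab =>
  Nat.sub_le_sub_right (h hab) J

lemma k2_anti (h : Antitone mu) : Antitone (k2 l J mu) := by
  intro a b hab
  unfold k2
  split_ifs with h1 h2 <;> try omega
  have := h (show l - 1 - b ≤ l - 1 - a by omega)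
  omega

/-- first component -/
def g1 (J : ℕ) (G : ℕ → ℕ → ℕ) : ℕ → ℕ → ℕ := fun k i => G k i - J
/-- second component -/
def g2 (l J : ℕ) (G : ℕ → ℕ → ℕ) : ℕ → ℕ → ℕ := fun k i =>
  if i < l then J - G (l - k) (l - 1 - i) else 0
/-- recombination -/
def gg (l J : ℕ) (A B : ℕ → ℕ → ℕ) : ℕ → ℕ → ℕ := fun k i =>
  if i < l then J + A k i - B (l - k) (l - 1 - i) else 0

lemma g1_isGT {G : ℕ → ℕ → ℕ} (hm : ∀ i, mu i ≤ J) (h : IsGT l lam mu G) :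
    IsGT l (k1 J lam) (fun _ => 0) (g1 J G) := by
  refine ⟨fun i => ?_, fun k hk i => ?_, fun k i => ?_, fun k i => ?_⟩ <;> simp only [g1, k1]
  · rw [h.zero]; have := hm i; omega
  · rw [h.top k hk]
  · have := h.mono k i; omega
  · have := h.inter k i; omega

lemma inter_any {n : ℕ} {G : ℕ → ℕ → ℕ} (h : IsGT n lam mu G) (k i : ℕ) :
    G k (i + 1) ≤ G (k - 1) i := by
  rcases k with _ | k
  · exact h.antitone 0 (Nat.le_succ i)
  · exact h.inter k i

lemma g2_isGT {G : ℕ → ℕ → ℕ} (hL : ∀ i, i < l → J ≤ lam i) (h : IsGT l lam mu G) :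
    IsGT l (k2 l J mu) (fun _ => 0) (g2 l J G) := by
  refine ⟨fun i => ?_, fun k hk i => ?_, fun k i => ?_, fun k i => ?_⟩ <;> simp only [g2, k2]
  · split_ifs with hi
    · rw [h.top _ (by omega)]; have := hL (l - 1 - i) (by omega); omega
    · rfl
  · rw [show l - k = 0 by omega, h.zero]
  · split_ifs with hi
    · have := h.monotone (l - 1 - i) (show l - (k + 1) ≤ l - k by omega)
      simp only at this
      omega
    · rfl
  · split_ifs with hi h2
    · have := inter_any h (l - k) (l - 1 - (i + 1))
      rw [show l - 1 - (i + 1) + 1 = l - 1 - i by omega,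
        show l - k - 1 = l - (k + 1) by omega] at this
      omega
    · omega
    · omega
    · rfl

lemma gg_isGT {A B : ℕ → ℕ → ℕ} (hl : ∀ i, l ≤ i → lam i = 0) (hL : ∀ i, i < l → J ≤ lam i)
    (hm : ∀ i, mu i ≤ J) (hm0 : ∀ i, l ≤ i → mu i = 0)
    (hA : IsGT l (k1 J lam) (fun _ => 0) A) (hB : IsGT l (k2 l J mu) (fun _ => 0) B) :
    IsGT l lam mu (gg l J A B) := by
  refine ⟨fun i => ?_, fun k hk i => ?_, fun k i => ?_, fun k i => ?_⟩ <;> simp only [gg]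
  · split_ifs with hi
    · rw [hA.zero, hB.top _ (by omega)]
      simp only [k2]
      rw [if_pos (by omega), show l - 1 - (l - 1 - i) = i by omega]
      have := hm i; omega
    · exact (hm0 i (by omega)).symm
  · split_ifs with hi
    · rw [hA.top k hk, show l - k = 0 by omega, hB.zero]
      simp only [k1]
      have := hL i hi; omega
    · exact (hl i (by omega)).symm
  · split_ifs with hi
    · have h1 := hB.monotone (l - 1 - i) (show l - (k + 1) ≤ l - k by omega)
      have h2 := hA.mono k i
      simp only at h1
      omega
    · rfl
  · split_ifs with hi h2
    · have h1 := inter_any hB (l - k) (l - 1 - (i + 1))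
      rw [show l - 1 - (i + 1) + 1 = l - 1 - i by omega,
        show l - k - 1 = l - (k + 1) by omega] at h1
      have h2 := hA.inter k i
      omega
    · omega
    · omega
    · rfl

lemma gg_g {G : ℕ → ℕ → ℕ} (hl : ∀ i, l ≤ i → lam i = 0) (h : IsGT l lam mu G) :
    gg l J (g1 J G) (g2 l J G) = G := by
  funext k i
  simp only [gg, g1, g2]
  split_ifs with hi h2
  · rw [show l - 1 - (l - 1 - i) = i by omega]
    rcases Nat.lt_or_ge l k with hk | hk
    · rw [show l - (l - k) = l by omega, h.top k hk.le, h.top l le_rfl]; omega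
    · rw [show l - (l - k) = k by omega]; omega
  · omega
  · have := h.le_top k i
    rw [hl i (by omega)] at this; omega

lemma gB_le {B : ℕ → ℕ → ℕ} (hB : IsGT l (k2 l J mu) (fun _ => 0) B) (k i : ℕ) : B k i ≤ J := by
  have := hB.le_top k i
  unfold k2 at this
  split_ifs at this <;> omega

lemma g1_gg {A B : ℕ → ℕ → ℕ} (hl : ∀ i, l ≤ i → lam i = 0)
    (hA : IsGT l (k1 J lam) (fun _ => 0) A) (hB : IsGT l (k2 l J mu) (fun _ => 0) B) :
    g1 J (gg l J A B) = A := by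
  funext k i
  simp only [gg, g1]
  split_ifs with hi
  · rcases Nat.lt_or_ge i k with hk | hk
    · rw [straight_zero hB (l - k) (l - 1 - i) (by omega)]; omega
    · rw [straight_zero hA k i hk]; omega
  · have := hA.le_top k i
    rw [k1_zero hl i (by omega)] at this; omega

lemma g2_gg {A B : ℕ → ℕ → ℕ}
    (hA : IsGT l (k1 J lam) (fun _ => 0) A) (hB : IsGT l (k2 l J mu) (fun _ => 0) B) :
    g2 l J (gg l J A B) = B := by
  funext k i
  simp only [gg, g2]
  split_ifs with hi h2
  · rw [show l - 1 - (l - 1 - i) = i by omega]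
    have hb := gB_le hB k i
    rcases Nat.lt_or_ge l k with hk | hk
    · rw [show l - (l - k) = l by omega, show l - k = 0 by omega, hA.zero, hB.top l le_rfl,
        hB.top k hk.le]
      rw [hB.top k hk.le] at hb
      omega
    · rw [show l - (l - k) = k by omega]
      rcases Nat.lt_or_ge (l - 1 - i) (l - k) with hk' | hk'
      · rw [straight_zero hB k i (by omega)]; omega
      · rw [straight_zero hA (l - k) (l - 1 - i) hk']; omega
  · omega
  · have := hB.le_top k i
    rw [k2_zero i (by omega)] at this; omega

lemma wt_g {G : ℕ → ℕ → ℕ} (h : IsGT l lam mu G) (k : ℕ) (hk : k < l) :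
    wt l G k = wt l (g1 J G) k + wt l (g2 l J G) (l - 1 - k) := by
  unfold wt
  rw [← Finset.sum_range_reflect (fun i => g2 l J G (l - 1 - k + 1) i - g2 l J G (l - 1 - k) i),
    ← Finset.sum_add_distrib]
  refine Finset.sum_congr rfl fun i hi => ?_
  have hi := Finset.mem_range.1 hi
  simp only [g1, g2]
  rw [if_pos (by omega), if_pos (by omega), show l - 1 - (l - 1 - i) = i by omega,
    show l - (l - 1 - k + 1) = k by omega, show l - (l - 1 - k) = k + 1 by omega]
  have := h.mono k i
  omega

theorem sch_factor (hl : ∀ i, l ≤ i → lam i = 0) (hL : ∀ i, i < l → J ≤ lam i) (hl0 : 0 < l)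
    (hm : ∀ i, mu i ≤ J) (hm0 : ∀ i, l ≤ i → mu i = 0) :
    sch l l lam mu hl = sch l l (k1 J lam) (fun _ => 0) (k1_zero hl) *
      sch l l (k2 l J mu) (fun _ => 0) k2_zero := by
  rw [← sch_symm l l (k2 l J mu) (fun _ => 0) k2_zero hl0 Fin.revPerm]
  unfold sch
  rw [map_sum, Finset.sum_mul_sum, ← Finset.sum_product']
  refine Finset.sum_nbij' (fun G => (g1 J G, g2 l J G)) (fun p => gg l J p.1 p.2) ?_ ?_ ?_ ?_ ?_
  · intro G hG
    rw [mem_gts] at hG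
    rw [Finset.mem_product, mem_gts, mem_gts]
    exact ⟨g1_isGT hm hG, g2_isGT hL hG⟩
  · intro p hp
    rw [Finset.mem_product, mem_gts, mem_gts] at hp
    rw [mem_gts]
    exact gg_isGT hl hL hm hm0 hp.1 hp.2
  · intro G hG
    rw [mem_gts] at hG
    exact gg_g hl hG
  · intro p hp
    rw [Finset.mem_product, mem_gts, mem_gts] at hp
    exact Prod.ext (g1_gg hl hp.1 hp.2) (g2_gg hp.1 hp.2)
  · intro G hG
    rw [mem_gts] at hG
    rw [map_prod]
    simp only [map_pow, MvPolynomial.rename_X]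
    rw [← Equiv.prod_comp Fin.revPerm
      (fun x : Fin l => (MvPolynomial.X (Fin.revPerm x) : MvPolynomial (Fin l) ℤ) ^ _)]
    rw [← Finset.prod_mul_distrib]
    refine Finset.prod_congr rfl fun k _ => ?_
    simp only [Fin.revPerm_apply, Fin.rev_rev]
    rw [← pow_add, wt_g (J := J) hG k k.2]
    congr 2
    rw [Fin.val_rev]
    congr 1
    omega

theorem alt_factor (hl : ∀ i, l ≤ i → lam i = 0) (hL : ∀ i, i < l → J ≤ lam i) (hl0 : 0 < l)
    (hm : ∀ i, mu i ≤ J) (hm0 : ∀ i, l ≤ i → mu i = 0) (hla : Antitone lam) (hma : Antitone mu) :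
    alt l (dl l fun _ => 0) * ∑ G ∈ ggts l l lam mu hl, alt l (dl l (wt l G)) =
      alt l (dl l (k1 J lam)) * alt l (dl l (k2 l J mu)) := by
  rw [← alt_mul_sch_good _ _ _ _ _ hl0, sch_factor (J := J) hl hL hl0 hm hm0,
    ← alt_mul_sch_straight l _ (k1_zero hl) hl0 (k1_anti hla),
    ← alt_mul_sch_straight l _ k2_zero hl0 (k2_anti hma)]
  ring

end

/-! ### Littlewood–Richardson fillings and good patterns -/

lemma lower_card (S : Finset ℕ) (h : ∀ a b, a ≤ b → b ∈ S → a ∈ S) (j : ℕ) :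
    j ∈ S ↔ j < S.card := by
  constructor
  · intro hj
    have : Finset.range (j + 1) ⊆ S := fun a ha => h a j (by
      have := Finset.mem_range.1 ha; omega) hj
    have := Finset.card_le_card this
    rw [Finset.card_range] at this
    omega
  · intro hj
    by_contra hcon
    have : S ⊆ Finset.range j := fun a ha => by
      rw [Finset.mem_range]
      by_contra hh
      exact hcon (h j a (by omega) ha)
    have := Finset.card_le_card this
    rw [Finset.card_range] at this
    omega

section
variable {lam mu : YoungDiagram}

lemma mem_skew {i j : ℕ} : (i, j) ∈ skewCells lam mu ↔ mu.rowLen i ≤ j ∧ j < lam.rowLen i := by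
  unfold skewCells
  rw [Finset.mem_sdiff, mem_cells, mem_cells, mem_iff_lt_rowLen, mem_iff_lt_rowLen]
  omega

lemma rowLen_mono (h : mu ≤ lam) (i : ℕ) : mu.rowLen i ≤ lam.rowLen i := by
  by_contra hcon
  have h1 : (i, lam.rowLen i) ∈ mu := mem_iff_lt_rowLen.2 (by omega)
  have h2 : (i, lam.rowLen i) ∈ lam := h h1
  rw [mem_iff_lt_rowLen] at h2
  omega

lemma rowLen_zero {l : ℕ} (h : lam.colLen 0 ≤ l) : ∀ i, l ≤ i → lam.rowLen i = 0 := by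
  intro i hi
  by_contra hcon
  have h1 : (i, 0) ∈ lam := mem_iff_lt_rowLen.2 (by omega)
  rw [mem_iff_lt_colLen] at h1
  omega

/-- From fillings to patterns. -/
def toG (lam : YoungDiagram) (T : ℕ × ℕ → ℕ) : ℕ → ℕ → ℕ := fun k i =>
  ((Finset.range (lam.rowLen i)).filter fun j => T (i, j) ≤ k).card

/-- From patterns to fillings. -/
noncomputable def toT (n : ℕ) (lam mu : YoungDiagram) (G : ℕ → ℕ → ℕ) : ℕ × ℕ → ℕ := fun p =>
  if p ∈ skewCells lam mu then ((Finset.range n).filter fun k => G k p.1 ≤ p.2).card else 0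

lemma ssyt_zero {T : ℕ × ℕ → ℕ} (h : IsSSYT lam mu T) {i j : ℕ} (hj : j < mu.rowLen i) :
    T (i, j) = 0 := by
  by_contra hcon
  have := (h.1 (i, j)).2 hcon
  rw [mem_skew] at this
  omega

lemma toG_iff {T : ℕ × ℕ → ℕ} (h : IsSSYT lam mu T) (i j k : ℕ) :
    j < toG lam T k i ↔ j < lam.rowLen i ∧ T (i, j) ≤ k := by
  unfold toG
  rw [← lower_card]
  · rw [Finset.mem_filter, Finset.mem_range]
  · intro a b hab hb
    rw [Finset.mem_filter, Finset.mem_range] at hb ⊢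
    refine ⟨by omega, ?_⟩
    rcases Nat.lt_or_ge a (mu.rowLen i) with ha | ha
    · rw [ssyt_zero h ha]; omega
    · exact (h.2.1 i a b (mem_skew.2 ⟨ha, by omega⟩) (mem_skew.2 ⟨by omega, hb.1⟩) hab).trans hb.2

lemma toT_iff {n : ℕ} {G : ℕ → ℕ → ℕ} (h : IsGT n lam.rowLen mu.rowLen G) {i j : ℕ}
    (hp : (i, j) ∈ skewCells lam mu) (k : ℕ) : toT n lam mu G (i, j) ≤ k ↔ j < G k i := by
  unfold toT
  rw [if_pos hp, ← not_lt, ← lower_card]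
  · rw [Finset.mem_filter, Finset.mem_range]
    constructor
    · intro hh
      by_cases hk : k < n
      · by_contra hcon
        exact hh ⟨hk, by simpa using hcon⟩
      · rw [h.top k (by omega)]
        exact (mem_skew.1 hp).2
    · rintro hh ⟨_, h2⟩
      simp only at h2
      omega
  · intro a b hab hb
    rw [Finset.mem_filter, Finset.mem_range] at hb ⊢
    have := h.monotone i hab
    simp only at this hb ⊢
    omega

lemma eq_of_lt_iff {a b : ℕ} (h : ∀ j, j < a ↔ j < b) : a = b := by
  have h1 := h a
  have h2 := h b
  omega

lemma toG_isGT {n : ℕ} {T : ℕ × ℕ → ℕ} (hmu : mu ≤ lam) (h : IsSSYT lam mu T)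
    (hn : ∀ p, T p ≤ n) : IsGT n lam.rowLen mu.rowLen (toG lam T) := by
  refine ⟨fun i => ?_, fun k hk i => ?_, fun k i => ?_, fun k i => ?_⟩
  · refine eq_of_lt_iff fun j => ?_
    rw [toG_iff h]
    constructor
    · rintro ⟨h1, h2⟩
      by_contra hcon
      have := (h.1 (i, j)).1 (mem_skew.2 ⟨by omega, h1⟩)
      omega
    · intro hj
      have := rowLen_mono hmu i
      refine ⟨by omega, ?_⟩
      rw [ssyt_zero h hj]
  · refine eq_of_lt_iff fun j => ?_
    rw [toG_iff h]
    have := hn (i, j)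
    constructor
    · exact fun h => h.1
    · exact fun h => ⟨h, by omega⟩
  · refine Finset.card_le_card fun j hj => ?_
    rw [Finset.mem_filter] at hj ⊢
    exact ⟨hj.1, by omega⟩
  · by_contra hcon
    have h1 := (toG_iff h (i + 1) (toG lam T k i) (k + 1)).1 (by omega)
    have h2 := (toG_iff h i (toG lam T k i) k).not.1 (by omega)
    set j := toG lam T k i
    have h3 : lam.rowLen (i + 1) ≤ lam.rowLen i := lam.rowLen_anti i (i + 1) (by omega)
    have h4 : mu.rowLen (i + 1) ≤ mu.rowLen i := mu.rowLen_anti i (i + 1) (by omega)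
    have h5 : ¬ j < mu.rowLen i := fun hh => h2 ⟨by omega, by rw [ssyt_zero h hh]; omega⟩
    have h6 := h.2.2 i (i + 1) j (mem_skew.2 ⟨by omega, by omega⟩)
      (mem_skew.2 ⟨by omega, by omega⟩) (by omega)
    exact h2 ⟨by omega, by omega⟩

lemma toT_ssyt {n : ℕ} {G : ℕ → ℕ → ℕ} (h : IsGT n lam.rowLen mu.rowLen G) :
    IsSSYT lam mu (toT n lam mu G) := by
  refine ⟨fun ⟨i, j⟩ => ?_, fun i j1 j2 h1 h2 hj => ?_, fun i1 i2 j h1 h2 hi => ?_⟩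
  · constructor
    · intro hp h0
      have := (toT_iff h hp 0).1 (by omega)
      rw [h.zero] at this
      rw [mem_skew] at hp
      omega
    · intro hne
      by_contra hp
      exact hne (by unfold toT; rw [if_neg hp])
  · rw [toT_iff h h1]
    have := (toT_iff h h2 _).1 le_rfl
    omega
  · have e := (toT_iff h h2 _).1 le_rfl
    rcases hk : toT n lam mu G (i2, j) with _ | k
    · rw [hk, h.zero] at e
      rw [mem_skew] at h2
      omega
    · rw [hk] at e
      rw [Nat.lt_succ_iff, toT_iff h h1]
      have a1 := h.antitone (k + 1) (show i1 + 1 ≤ i2 by omega)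
      have a2 := h.inter k i1
      omega

lemma toG_toT {n : ℕ} {G : ℕ → ℕ → ℕ} (hmu : mu ≤ lam) (h : IsGT n lam.rowLen mu.rowLen G) :
    toG lam (toT n lam mu G) = G := by
  funext k i
  refine eq_of_lt_iff fun j => ?_
  rw [toG_iff (toT_ssyt h)]
  have h1 := h.le_top k i
  have h2 := h.monotone i (Nat.zero_le k)
  simp only [h.zero] at h2
  by_cases hp : (i, j) ∈ skewCells lam mu
  · rw [toT_iff h hp]
    omega
  · have e : toT n lam mu G (i, j) = 0 := by unfold toT; rw [if_neg hp]
    rw [e]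
    rw [mem_skew] at hp
    omega

lemma toT_toG {n : ℕ} {T : ℕ × ℕ → ℕ} (hmu : mu ≤ lam) (h : IsSSYT lam mu T)
    (hn : ∀ p, T p ≤ n) : toT n lam mu (toG lam T) = T := by
  funext ⟨i, j⟩
  by_cases hp : (i, j) ∈ skewCells lam mu
  · have key : ∀ k, toT n lam mu (toG lam T) (i, j) ≤ k ↔ T (i, j) ≤ k := fun k => by
      rw [toT_iff (toG_isGT hmu h hn) hp, toG_iff h]
      have := (mem_skew.1 hp).2
      tauto
    have h1 := (key _).1 le_rfl
    have h2 := (key _).2 le_rfl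
    omega
  · have : T (i, j) = 0 := by
      by_contra hcon
      exact hp ((h.1 _).2 hcon)
    rw [this]; unfold toT; rw [if_neg hp]

lemma label_iff {T : ℕ × ℕ → ℕ} (h : IsSSYT lam mu T) (i j k : ℕ) :
    ((i, j) ∈ skewCells lam mu ∧ T (i, j) = k + 1) ↔ toG lam T k i ≤ j ∧ j < toG lam T (k + 1) i := by
  rw [toG_iff h, ← not_lt, toG_iff h]
  constructor
  · rintro ⟨h1, h2⟩
    have := mem_skew.1 h1
    omega
  · rintro ⟨h1, h2⟩
    have : T (i, j) = k + 1 := by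
      by_contra hcon
      exact h1 ⟨h2.1, by omega⟩
    exact ⟨(h.1 _).2 (by omega), this⟩

/-- Embedding of a row. -/
def rowEmb (t : ℕ) : ℕ ↪ ℕ × ℕ := ⟨fun x => (t, x), fun _ _ h => (Prod.ext_iff.1 h).2⟩

lemma rowEmb_apply (t x : ℕ) : rowEmb t x = (t, x) := rfl

lemma prefix_eq {T : ℕ × ℕ → ℕ} (h : IsSSYT lam mu T) (i j k : ℕ) :
    prefixCount lam mu T i j (k + 1) =
      ∑ t ∈ Finset.range i, (toG lam T (k + 1) t - toG lam T k t) +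
        (toG lam T (k + 1) i - max j (toG lam T k i)) := by
  have e : ∀ t ∈ Finset.range i, toG lam T (k + 1) t - toG lam T k t =
      toG lam T (k + 1) t - max (if t = i then j else 0) (toG lam T k t) := by
    intro t ht
    rw [if_neg (by have := Finset.mem_range.1 ht; omega)]
    simp
  rw [Finset.sum_congr rfl e]
  have e2 : toG lam T (k + 1) i - max j (toG lam T k i) =
    toG lam T (k + 1) i - max (if i = i then j else 0) (toG lam T k i) := by simp
  rw [e2, ← Finset.sum_range_succ (fun t => toG lam T (k + 1) t -
    max (if t = i then j else 0) (toG lam T k t))]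
  unfold prefixCount
  rw [Finset.card_eq_sum_card_fiberwise (f := Prod.fst) (t := Finset.range (i + 1))]
  · refine Finset.sum_congr rfl fun t ht => ?_
    have ht := Finset.mem_range.1 ht
    rw [← Nat.card_Ico]
    refine Eq.trans ?_
      (Finset.card_map (rowEmb t))
    refine congrArg Finset.card ?_
    ext ⟨a, b⟩
    simp only [Finset.mem_filter, Finset.mem_map, Finset.mem_Ico, rowEmb_apply,
      Prod.mk.injEq]
    constructor
    · rintro ⟨⟨h1, h2, h3⟩, rfl⟩
      have := (label_iff h a b k).1 ⟨h1, h3⟩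
      refine ⟨b, ⟨?_, this.2⟩, rfl, rfl⟩
      split_ifs with hh <;> omega
    · rintro ⟨x, ⟨h1, h2⟩, rfl, rfl⟩
      have := (label_iff h t x k).2 ⟨by omega, h2⟩
      refine ⟨⟨this.1, ?_, this.2⟩, rfl⟩
      split_ifs at h1 with hh <;> omega
  · intro p hp
    simp only [Finset.coe_filter, Set.mem_ofPred_eq] at hp
    simp only [Finset.coe_range, Set.mem_Iio]
    omega

lemma content_eq {l : ℕ} {T : ℕ × ℕ → ℕ} (hl : lam.colLen 0 ≤ l) (h : IsSSYT lam mu T) (k : ℕ) :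
    content lam mu T (k + 1) = wt l (toG lam T) k := by
  unfold content wt
  rw [Finset.card_eq_sum_card_fiberwise (f := Prod.fst) (t := Finset.range l)]
  · refine Finset.sum_congr rfl fun t ht => ?_
    rw [← Nat.card_Ico]
    refine Eq.trans ?_
      (Finset.card_map (rowEmb t))
    refine congrArg Finset.card ?_
    ext ⟨a, b⟩
    simp only [Finset.mem_filter, Finset.mem_map, Finset.mem_Ico, rowEmb_apply,
      Prod.mk.injEq]
    constructor
    · rintro ⟨h1, rfl⟩
      exact ⟨b, (label_iff h a b k).1 h1, rfl, rfl⟩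
    · rintro ⟨x, h1, rfl, rfl⟩
      exact ⟨(label_iff h t x k).2 h1, rfl⟩
  · rintro ⟨a, b⟩ hp
    simp only [Finset.coe_filter, Set.mem_ofPred_eq] at hp
    simp only [Finset.coe_range, Set.mem_Iio]
    have := (mem_skew.1 hp.1).2
    by_contra hcon
    rw [rowLen_zero hl a (by omega)] at this
    omega

lemma lattice_iff {n : ℕ} {T : ℕ × ℕ → ℕ} (h : IsSSYT lam mu T)
    (hG : IsGT n lam.rowLen mu.rowLen (toG lam T)) : IsLattice lam mu T ↔ Good (toG lam T) := by
  have key : ∀ i j k, prefixCount lam mu T i j (k + 1) =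
      wt i (toG lam T) k + (toG lam T (k + 1) i - max j (toG lam T k i)) :=
    fun i j k => prefix_eq h i j k
  have key2 : ∀ i j k, prefixCount lam mu T i j (k + 2) =
      wt i (toG lam T) (k + 1) + (toG lam T (k + 2) i - max j (toG lam T (k + 1) i)) :=
    fun i j k => prefix_eq h i j (k + 1)
  constructor
  · intro hL i k hb
    have := hL i (toG lam T (k + 1) i) k
    rw [key2, key] at this
    unfold Bad at hb
    rw [PS_succ, PS_succ] at hb
    have e1 := hG.wt_add i k
    have e2 := hG.wt_add2 i k
    omega
  · intro hg i j k
    have hb := hg i k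
    have m1 := hG.mono k i
    have m2 := hG.mono2 k i
    rw [key2, key]
    unfold Bad at hb
    rw [PS_succ, PS_succ] at hb
    have e1 := hG.wt_add i k
    have e2 := hG.wt_add2 i k
    omega

lemma lattice_bound {T : ℕ × ℕ → ℕ} (h : IsSSYT lam mu T) (hL : IsLattice lam mu T) :
    ∀ i j, T (i, j) ≤ i + 1 := by
  intro i
  induction i using Nat.strong_induction_on with
  | _ i ih =>
    intro j
    by_contra hcon
    obtain ⟨k, hk⟩ : ∃ k, T (i, j) = k + 2 := ⟨T (i, j) - 2, by omega⟩
    have hp : (i, j) ∈ skewCells lam mu := (h.1 _).2 (by omega)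
    have h1 : 0 < prefixCount lam mu T i j (k + 2) := by
      unfold prefixCount
      rw [Finset.card_pos]
      exact ⟨(i, j), Finset.mem_filter.2 ⟨hp, Or.inr ⟨rfl, le_rfl⟩, hk⟩⟩
    have h2 := lt_of_lt_of_le h1 (hL i j k)
    unfold prefixCount at h2
    rw [Finset.card_pos] at h2
    obtain ⟨⟨a, b⟩, hab⟩ := h2
    rw [Finset.mem_filter] at hab
    obtain ⟨q1, q2, q3⟩ := hab
    simp only at q2
    rcases q2 with q2 | ⟨rfl, q2⟩
    · have := ih a q2 b
      omega
    · have := h.2.1 a j b hp q1 q2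
      omega

lemma lattice_bound' {n : ℕ} (hn : lam.colLen 0 ≤ n) {T : ℕ × ℕ → ℕ} (h : IsSSYT lam mu T)
    (hL : IsLattice lam mu T) (p : ℕ × ℕ) : T p ≤ n := by
  obtain ⟨i, j⟩ := p
  by_cases hp : (i, j) ∈ skewCells lam mu
  · have h1 := (mem_skew.1 hp).2
    have h2 := lattice_bound h hL i j
    by_contra hcon
    rw [rowLen_zero hn i (by omega)] at h1
    omega
  · have : T (i, j) = 0 := by
      by_contra hcon
      exact hp ((h.1 _).2 hcon)
    omega

lemma lr_count {n : ℕ} (hn : lam.colLen 0 ≤ n) (hmu : mu ≤ lam) (nu : YoungDiagram) :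
    lrCoeff lam mu nu = ((ggts n n lam.rowLen mu.rowLen (rowLen_zero hn)).filter
      fun G => nu.rowLen = wt n G).card := by
  unfold lrCoeff
  rw [if_pos hmu, ← Set.ncard_coe_finset]
  symm
  refine Set.ncard_congr (fun G _ => toT n lam mu G) ?_ ?_ ?_
  · intro G hG
    simp only [ggts, Finset.coe_filter, Set.mem_ofPred_eq, Finset.mem_filter, mem_gts] at hG
    obtain ⟨⟨h1, h2⟩, h3⟩ := hG
    have hs := toT_ssyt h1
    have e := toG_toT hmu h1
    refine ⟨hs, (lattice_iff hs (by rw [e]; exact h1)).2 (by rw [e]; exact h2), fun i => ?_⟩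
    rw [content_eq hn hs, e, h3]
  · intro G G' hG hG' hh
    simp only [ggts, Finset.coe_filter, Set.mem_ofPred_eq, Finset.mem_filter, mem_gts] at hG hG'
    rw [← toG_toT hmu hG.1.1, hh, toG_toT hmu hG'.1.1]
  · rintro T ⟨hs, hL, hc⟩
    have hb := lattice_bound' hn hs hL
    have hG := toG_isGT hmu hs hb
    refine ⟨toG lam T, ?_, toT_toG hmu hs hb⟩
    simp only [ggts, Finset.coe_filter, Set.mem_ofPred_eq, Finset.mem_filter, mem_gts]
    refine ⟨⟨hG, (lattice_iff hs hG).1 hL⟩, ?_⟩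
    funext i
    rw [← hc i, content_eq hn hs]

end

/-- Young diagram with given antitone row lengths. -/
def ydOf (l : ℕ) (v : ℕ → ℕ) (hv : Antitone v) : YoungDiagram :=
  ⟨(Finset.range l ×ˢ Finset.range (v 0)).filter fun p => p.2 < v p.1, by
    intro a b hba ha
    simp only [Finset.coe_filter, Set.mem_ofPred_eq, Finset.mem_product, Finset.mem_range] at ha ⊢
    have h1 := hba.1
    have h2 := hba.2
    have h3 := hv h1
    omega⟩

lemma ydOf_rowLen (l : ℕ) (v : ℕ → ℕ) (hv : Antitone v) (h0 : ∀ i, l ≤ i → v i = 0) :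
    (ydOf l v hv).rowLen = v := by
  funext i
  refine eq_of_lt_iff fun j => ?_
  rw [← mem_iff_lt_rowLen, ← mem_cells]
  simp only [ydOf, Finset.mem_filter, Finset.mem_product, Finset.mem_range]
  have := hv (Nat.zero_le i)
  constructor
  · exact fun h => h.2
  · intro h
    have : i < l := by
      by_contra hcon
      rw [h0 i (by omega)] at h
      omega
    omega

lemma wt_yd {n : ℕ} {lam mu : ℕ → ℕ} {hl : ∀ i, n ≤ i → lam i = 0} {G : ℕ → ℕ → ℕ}
    (hG : G ∈ ggts n n lam mu hl) : ∃ nu : YoungDiagram, nu.rowLen = wt n G := by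
  simp only [ggts, Finset.mem_filter, mem_gts] at hG
  obtain ⟨h, hg⟩ := hG
  refine ⟨ydOf n (wt n G) (antitone_nat_of_succ_le fun k => ?_), ydOf_rowLen _ _ _ fun k hk => ?_⟩
  · have hb := hg n k
    unfold Bad at hb
    have e1 := h.wt_add n k
    have e2 := h.wt_add2 n k
    have z : ∀ k, G k n = 0 := fun k => by
      have := h.le_top k n
      rw [hl n le_rfl] at this; omega
    rw [PS_succ, PS_succ, z, z] at hb
    omega
  · unfold wt
    refine Finset.sum_eq_zero fun i _ => ?_
    rw [h.top _ (by omega), h.top k hk]; omega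

theorem wt_multiset {lam mu alp bet : YoungDiagram} {n : ℕ} (h1 : lam.colLen 0 ≤ n)
    (h2 : alp.colLen 0 ≤ n) (hmu : mu ≤ lam) (hbet : bet ≤ alp) (h : SchurEq lam mu alp bet) :
    (ggts n n lam.rowLen mu.rowLen (rowLen_zero h1)).val.map (wt n) =
    (ggts n n alp.rowLen bet.rowLen (rowLen_zero h2)).val.map (wt n) := by
  ext v
  rw [Multiset.count_map, Multiset.count_map]
  by_cases hv : ∃ nu : YoungDiagram, nu.rowLen = v
  · obtain ⟨nu, rfl⟩ := hv
    have := h nu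
    rw [lr_count h1 hmu, lr_count h2 hbet] at this
    exact this
  · have z : ∀ (lam mu : YoungDiagram) (h1 : lam.colLen 0 ≤ n),
        (Multiset.filter (fun G => v = wt n G)
          (ggts n n lam.rowLen mu.rowLen (rowLen_zero h1)).val) = 0 := by
      intro lam mu h1
      rw [Multiset.filter_eq_nil]
      rintro G hG rfl
      exact hv (wt_yd hG)
    rw [z lam mu h1, z alp bet h2]

lemma wt_transfer {lam mu alp bet : YoungDiagram} {n : ℕ} (h1 : lam.colLen 0 ≤ n)
    (h2 : alp.colLen 0 ≤ n) (hmu : mu ≤ lam) (hbet : bet ≤ alp) (h : SchurEq lam mu alp bet)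
    {G : ℕ → ℕ → ℕ} (hG : IsGT n lam.rowLen mu.rowLen G) (hg : Good G) :
    ∃ G', IsGT n alp.rowLen bet.rowLen G' ∧ Good G' ∧ wt n G' = wt n G := by
  have hm := wt_multiset h1 h2 hmu hbet h
  have : wt n G ∈ (ggts n n lam.rowLen mu.rowLen (rowLen_zero h1)).val.map (wt n) :=
    Multiset.mem_map.2 ⟨G, by
      simp only [ggts, Finset.mem_val, Finset.mem_filter, mem_gts]; exact ⟨hG, hg⟩, rfl⟩
  rw [hm, Multiset.mem_map] at this
  obtain ⟨G', hG', e⟩ := this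
  simp only [ggts, Finset.mem_val, Finset.mem_filter, mem_gts] at hG'
  exact ⟨G', hG'.1, hG'.2, e⟩

/-! ### Explicit patterns -/

lemma good_stable {n : ℕ} {lam mu : ℕ → ℕ} {G : ℕ → ℕ → ℕ} (h : IsGT n lam mu G)
    (hg : Good G) : ∀ i, ∀ k, i < k → G k i = lam i := by
  intro i
  induction i using Nat.strong_induction_on with
  | _ i ih =>
    have step : ∀ k, i + 1 ≤ k → G (k + 1) i = G k i := by
      intro k hk
      obtain ⟨k, rfl⟩ : ∃ k', k = k' + 1 := ⟨k - 1, by omega⟩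
      have hb := hg i k
      unfold Bad at hb
      have e : ∀ k', i ≤ k' → PS G k' i = ∑ t ∈ Finset.range i, lam t := by
        intro k' hk'
        refine Finset.sum_congr rfl fun t ht => ?_
        have := Finset.mem_range.1 ht
        exact ih t this k' (by omega)
      rw [PS_succ, PS_succ, e _ (by omega), e _ (by omega), e _ (by omega)] at hb
      have := h.mono2 k i
      change G (k + 2) i = G (k + 1) i
      omega
    intro k hk
    have cst : ∀ m, G (k + m) i = G k i := by
      intro m
      induction m with
      | zero => rfl
      | succ m ihm => rw [← ihm]; exact step (k + m) (by omega)
    rw [← cst n, h.top _ (by omega)]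

lemma good_wt_zero {n l : ℕ} {lam mu : ℕ → ℕ} {G : ℕ → ℕ → ℕ} (h : IsGT n lam mu G)
    (hg : Good G) (hl : ∀ i, l ≤ i → lam i = 0) (k : ℕ) (hk : l ≤ k) (m : ℕ) : wt m G k = 0 := by
  unfold wt
  refine Finset.sum_eq_zero fun i _ => ?_
  rcases Nat.lt_or_ge i l with hi | hi
  · rw [good_stable h hg i (k + 1) (by omega), good_stable h hg i k (by omega)]; omega
  · have := h.le_top (k + 1) i
    rw [hl i hi] at this; omega

/-- Column counts of the row-justified diagram. -/
def cc (r : ℕ → ℕ) (i t : ℕ) : ℕ := ((Finset.range i).filter fun s => t < r s).card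

lemma cc_succ (r : ℕ → ℕ) (i t : ℕ) : cc r (i + 1) t = cc r i t + if t < r i then 1 else 0 := by
  unfold cc
  rw [Finset.range_add_one, Finset.filter_insert]
  split_ifs
  · rw [Finset.card_insert_of_notMem (by simp)]
  · rfl

lemma cc_le (r : ℕ → ℕ) (i t : ℕ) : cc r i t ≤ i := by
  unfold cc
  exact (Finset.card_filter_le _ _).trans (by rw [Finset.card_range])

/-- The pattern with partition the sorted rows. -/
def rowG (bet r : ℕ → ℕ) : ℕ → ℕ → ℕ := fun k i =>
  bet i + ((Finset.range (r i)).filter fun t => cc r (i + 1) t ≤ k).card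

lemma rowG_isGT {n : ℕ} {alp bet r : ℕ → ℕ} (hr : ∀ i, bet i + r i = alp i)
    (hn : ∀ i, n ≤ i → alp i = 0) (ha : Antitone alp) (hba : Antitone bet) :
    IsGT n alp bet (rowG bet r) := by
  refine ⟨fun i => ?_, fun k hk i => ?_, fun k i => ?_, fun k i => ?_⟩ <;> simp only [rowG]
  · rw [Finset.filter_false_of_mem]
    · simp
    · intro t ht
      rw [cc_succ, if_pos (Finset.mem_range.1 ht)]
      omega
  · rw [← hr i, Finset.filter_true_of_mem]
    · simp
    · intro t ht
      have := Finset.mem_range.1 ht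
      have := cc_le r (i + 1) t
      have : i < n := by
        by_contra hcon
        have h1 := hn i (by omega)
        have h2 := hr i
        omega
      omega
  · refine Nat.add_le_add_left (Finset.card_le_card fun t ht => ?_) _
    rw [Finset.mem_filter] at ht ⊢
    exact ⟨ht.1, by omega⟩
  · have hle := ha (Nat.le_succ i)
    simp only [Nat.succ_eq_add_one] at hle
    have h1 := hr i
    have h2 := hr (i + 1)
    have sub : (Finset.range (r (i + 1))).filter (fun t => cc r (i + 1 + 1) t ≤ k + 1) ⊆
        (Finset.range (r i)).filter (fun t => cc r (i + 1) t ≤ k) ∪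
          Finset.Ico (r i) (r (i + 1)) := by
      intro t ht
      rw [Finset.mem_filter, Finset.mem_range, cc_succ r (i + 1)] at ht
      rw [Finset.mem_union, Finset.mem_filter, Finset.mem_range, Finset.mem_Ico]
      rw [if_pos ht.1] at ht
      omega
    have c1 := (Finset.card_le_card sub).trans (Finset.card_union_le _ _)
    rw [Nat.card_Ico] at c1
    rcases Nat.lt_or_ge (r i) (r (i + 1)) with hh | hh
    · omega
    · have hb := hba (Nat.le_succ i)
      simp only [Nat.succ_eq_add_one] at hb
      omega

lemma rowG_wt {n : ℕ} {alp bet r : ℕ → ℕ} (h : IsGT n alp bet (rowG bet r)) (R : ℕ)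
    (hR : ∀ i, r i ≤ R) (k i : ℕ) :
    wt i (rowG bet r) k = ((Finset.range R).filter fun t => k + 1 ≤ cc r i t).card := by
  induction i with
  | zero =>
    rw [Finset.filter_false_of_mem]
    · simp [wt]
    · intro t _
      have := cc_le r 0 t
      omega
  | succ i ih =>
    have e1 : wt (i + 1) (rowG bet r) k = wt i (rowG bet r) k +
      (rowG bet r (k + 1) i - rowG bet r k i) := Finset.sum_range_succ _ _
    have e2 : ((Finset.range (r i)).filter fun t => cc r (i + 1) t ≤ k + 1).card =
        ((Finset.range (r i)).filter fun t => cc r (i + 1) t ≤ k).card +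
        ((Finset.range (r i)).filter fun t => cc r (i + 1) t = k + 1).card := by
      rw [← Finset.card_union_of_disjoint]
      · congr 1
        ext t
        simp only [Finset.mem_filter, Finset.mem_range, Finset.mem_union]
        omega
      · rw [Finset.disjoint_filter]
        intro t _ h1 h2
        omega
    have e3 : ((Finset.range R).filter fun t => k + 1 ≤ cc r (i + 1) t).card =
        ((Finset.range R).filter fun t => k + 1 ≤ cc r i t).card +
        ((Finset.range (r i)).filter fun t => cc r (i + 1) t = k + 1).card := by
      rw [← Finset.card_union_of_disjoint]
      · congr 1
        ext t
        have := hR i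
        simp only [Finset.mem_filter, Finset.mem_range, Finset.mem_union, cc_succ]
        split_ifs <;> omega
      · rw [Finset.disjoint_left]
        intro t h1 h2
        simp only [Finset.mem_filter, Finset.mem_range, cc_succ] at h1 h2
        rw [if_pos h2.1] at h2
        omega
    rw [e1, e3, ih]
    simp only [rowG]
    omega

lemma rowG_good {n : ℕ} {alp bet r : ℕ → ℕ} (h : IsGT n alp bet (rowG bet r)) (R : ℕ)
    (hR : ∀ i, r i ≤ R) : Good (rowG bet r) := by
  intro i k hb
  unfold Bad at hb
  have e1 := h.wt_add i k
  have e2 := h.wt_add2 (i + 1) k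
  have e3 : wt (i + 1) (rowG bet r) (k + 1) ≤ wt i (rowG bet r) k := by
    rw [rowG_wt h R hR, rowG_wt h R hR]
    refine Finset.card_le_card fun t ht => ?_
    rw [Finset.mem_filter, cc_succ] at ht
    rw [Finset.mem_filter]
    refine ⟨ht.1, ?_⟩
    split_ifs at ht <;> omega
  omega

lemma rowG_wt_pos {n l : ℕ} {alp bet r : ℕ → ℕ} (h : IsGT n alp bet (rowG bet r)) (R : ℕ)
    (hR : ∀ i, r i ≤ R) (hl0 : 0 < l) (hln : l ≤ n) (hpos : ∀ i, i < l → 0 < r i) :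
    0 < wt n (rowG bet r) (l - 1) := by
  rw [rowG_wt h R hR, Finset.card_pos]
  refine ⟨0, ?_⟩
  rw [Finset.mem_filter, Finset.mem_range]
  refine ⟨lt_of_lt_of_le (hpos 0 hl0) (hR 0), ?_⟩
  rw [Nat.sub_add_cancel hl0]
  unfold cc
  calc l = (Finset.range l).card := (Finset.card_range l).symm
    _ ≤ _ := Finset.card_le_card fun s hs => by
      rw [Finset.mem_filter]
      rw [Finset.mem_range] at hs ⊢
      exact ⟨by omega, hpos s hs⟩

lemma len_le {lam mu alp bet : YoungDiagram} (hmu : mu ≤ lam) (hbet : bet ≤ alp)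
    (hb : ∀ i, i < alp.colLen 0 → bet.rowLen i < alp.rowLen i)
    (h : SchurEq alp bet lam mu) : alp.colLen 0 ≤ lam.colLen 0 := by
  by_contra hcon
  have h2 : alp.colLen 0 ≤ alp.colLen 0 := le_rfl
  have h1 : lam.colLen 0 ≤ alp.colLen 0 := by omega
  set r : ℕ → ℕ := fun i => alp.rowLen i - bet.rowLen i with hr
  have hG : IsGT (alp.colLen 0) alp.rowLen bet.rowLen (rowG bet.rowLen r) :=
    rowG_isGT (fun i => by have := rowLen_mono hbet i; simp only [hr]; omega) (rowLen_zero h2)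
      (fun a b hab => alp.rowLen_anti a b hab) (fun a b hab => bet.rowLen_anti a b hab)
  have hR : ∀ i, r i ≤ alp.rowLen 0 := fun i => by
    have := alp.rowLen_anti 0 i (Nat.zero_le i)
    simp only [hr]; omega
  obtain ⟨G', g1, g2, g3⟩ := wt_transfer h2 h1 hbet hmu h hG (rowG_good hG _ hR)
  have p := rowG_wt_pos hG _ hR (l := alp.colLen 0) (by omega) le_rfl
    (fun i hi => by have := hb i hi; simp only [hr]; omega)
  rw [← g3, good_wt_zero g1 g2 (l := lam.colLen 0) (rowLen_zero le_rfl) _ (by omega)] at p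
  omega

/-- The pattern of the column filling. -/
def colG (alp bet : ℕ → ℕ) : ℕ → ℕ → ℕ := fun k i =>
  if k ≤ i then min (alp i) (bet (i - k)) else alp i

lemma colG_isGT {n : ℕ} {alp bet : ℕ → ℕ} (hab : ∀ i, bet i ≤ alp i)
    (hn : ∀ i, n ≤ i → alp i = 0) (ha : Antitone alp) (hb : Antitone bet) :
    IsGT n alp bet (colG alp bet) := by
  refine ⟨fun i => ?_, fun k hk i => ?_, fun k i => ?_, fun k i => ?_⟩ <;> simp only [colG]
  · have := hab i
    simp only [Nat.zero_le, if_true, Nat.sub_zero]; omega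
  · split_ifs with h
    · rw [hn i (by omega)]; omega
    · rfl
  · have := hb (show i - (k + 1) ≤ i - k by omega)
    split_ifs <;> omega
  · have := ha (Nat.le_succ i)
    simp only [Nat.succ_eq_add_one] at this
    rw [show i + 1 - (k + 1) = i - k by omega]
    split_ifs <;> omega

lemma colG_good {n : ℕ} {alp bet : ℕ → ℕ} (ha : Antitone alp) (hb : Antitone bet)
    (h : IsGT n alp bet (colG alp bet)) : Good (colG alp bet) := by
  intro i k hbad
  unfold Bad at hbad
  have e1 := h.wt_add i k
  have e2 := h.wt_add2 (i + 1) k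
  have e3 : wt (i + 1) (colG alp bet) (k + 1) ≤ wt i (colG alp bet) k := by
    unfold wt
    rw [Finset.sum_range_succ']
    have z : colG alp bet (k + 1 + 1) 0 - colG alp bet (k + 1) 0 = 0 := by simp [colG]
    rw [z, add_zero]
    refine Finset.sum_le_sum fun t _ => ?_
    simp only [colG]
    have a1 := ha (Nat.le_succ t)
    simp only [Nat.succ_eq_add_one] at a1
    have a2 := hb (show t - (k + 1) ≤ t - k by omega)
    rw [show t + 1 - (k + 1 + 1) = t - (k + 1) by omega,
      show t + 1 - (k + 1) = t - k by omega]
    split_ifs <;> omega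
  omega

lemma full_col {lam mu alp bet : YoungDiagram} (hmu : mu ≤ lam) (hbet : bet ≤ alp)
    (h : SchurEq alp bet lam mu) {l : ℕ} (hl : lam.colLen 0 = l) (hl' : alp.colLen 0 = l)
    (hl0 : 0 < l) (hfull : mu.rowLen 0 < lam.rowLen (l - 1)) :
    bet.rowLen 0 < alp.rowLen (l - 1) := by
  have ha : Antitone alp.rowLen := fun a b hab => alp.rowLen_anti a b hab
  have hb : Antitone bet.rowLen := fun a b hab => bet.rowLen_anti a b hab
  have hG := colG_isGT (rowLen_mono hbet) (rowLen_zero hl'.le) ha hb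
  obtain ⟨G', g1, g2, g3⟩ := wt_transfer hl'.le hl.le hbet hmu h hG (colG_good ha hb hG)
  have diag : ∀ k, G' k k ≤ mu.rowLen 0 := by
    intro k
    induction k with
    | zero => rw [g1.zero]
    | succ k ih => exact (g1.inter k k).trans ih
  have d := diag (l - 1)
  have p : 0 < wt l G' (l - 1) := by
    unfold wt
    refine lt_of_lt_of_le ?_ (Finset.single_le_sum (f := fun i => G' (l - 1 + 1) i - G' (l - 1) i)
      (fun _ _ => Nat.zero_le _) (Finset.mem_range.2 (show l - 1 < l by omega)))
    rw [g1.top _ (by omega)]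
    omega
  rw [g3] at p
  unfold wt at p
  rw [Finset.sum_eq_single (l - 1)] at p
  · simp only [colG] at p
    rw [if_neg (by omega), if_pos le_rfl, Nat.sub_self] at p
    omega
  · intro i hi hne
    have := Finset.mem_range.1 hi
    simp only [colG]
    rw [if_neg (by omega), if_neg (by omega)]; omega
  · intro hh
    exact absurd (Finset.mem_range.2 (show l - 1 < l by omega)) hh

/-! ### Assembly -/

lemma yd_ext {a b : YoungDiagram} (h : ∀ i, a.rowLen i = b.rowLen i) : a = b := by
  refine YoungDiagram.ext ?_
  ext ⟨i, j⟩
  rw [mem_cells, mem_cells, mem_iff_lt_rowLen, mem_iff_lt_rowLen, h]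

lemma complRect_rowLen (k l : ℕ) (nu : YoungDiagram) (i : ℕ) :
    (complRect k l nu).rowLen i = if i < l then k - nu.rowLen (l - 1 - i) else 0 := by
  refine eq_of_lt_iff fun j => ?_
  rw [← mem_iff_lt_rowLen, ← mem_cells]
  simp only [complRect, rect, Finset.mem_filter, Finset.mem_product, Finset.mem_range,
    mem_iff_lt_rowLen]
  split_ifs <;> omega

/-- Increasing rearrangement of `dl`. -/
def up (l : ℕ) (f : ℕ → ℕ) : Fin l → ℕ := fun i => i + f (l - 1 - i)

lemma up_mono (l : ℕ) {f : ℕ → ℕ} (hf : Antitone f) : StrictMono (up l f) := by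
  intro a b hab
  have h1 : (a : ℕ) < b := hab
  have h2 := hf (show l - 1 - (b : ℕ) ≤ l - 1 - a by omega)
  simp only [up]
  omega

lemma alt_up (l : ℕ) (f : ℕ → ℕ) :
    alt l (up l f) = (Equiv.Perm.sign (Fin.revPerm (n := l)) : ℤ) * alt l (dl l f) := by
  rw [← alt_perm]
  congr 1
  funext i
  simp only [up, dl, Fin.revPerm_apply, Fin.val_rev]
  rw [show l - ((i : ℕ) + 1) = l - 1 - i by omega]
  omega

theorem main_aux (lam mu alp bet : YoungDiagram)
    (hmu : mu ≤ lam) (hbet : bet ≤ alp)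
    (hbasic1 : IsBasic lam mu) (hbasic2 : IsBasic alp bet)
    (hcol : ∃ j, j < lam.rowLen 0 ∧ mu.colLen j = 0 ∧ lam.colLen j = lam.colLen 0)
    (h : SchurEq lam mu alp bet) :
    (alp = lam ∧ bet = mu) ∨
      (alp = complRect (lam.rowLen 0) (lam.colLen 0) mu ∧
        bet = complRect (lam.rowLen 0) (lam.colLen 0) lam) := by
  have h' : SchurEq alp bet lam mu := fun nu => (h nu).symm
  have hlen : alp.colLen 0 = lam.colLen 0 :=
    le_antisymm (len_le hmu hbet hbasic2.1 h') (len_le hbet hmu hbasic1.1 h)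
  obtain ⟨j, j1, j2, j3⟩ := hcol
  obtain ⟨l, hl⟩ : ∃ l, lam.colLen 0 = l := ⟨_, rfl⟩
  rw [hl] at hlen j3 ⊢
  have hl0 : 0 < l := by
    rw [← hl, ← mem_iff_lt_colLen, mem_iff_lt_rowLen]; omega
  have hfull : mu.rowLen 0 < lam.rowLen (l - 1) := by
    have q1 : ¬ (0, j) ∈ mu := by rw [mem_iff_lt_colLen]; omega
    have q2 : (l - 1, j) ∈ lam := by rw [mem_iff_lt_colLen]; omega
    rw [mem_iff_lt_rowLen] at q1 q2
    omega
  have hfull' := full_col hmu hbet h' hl hlen hl0 hfull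
  have la : Antitone lam.rowLen := fun a b hab => lam.rowLen_anti a b hab
  have ma : Antitone mu.rowLen := fun a b hab => mu.rowLen_anti a b hab
  have aa : Antitone alp.rowLen := fun a b hab => alp.rowLen_anti a b hab
  have ba : Antitone bet.rowLen := fun a b hab => bet.rowLen_anti a b hab
  have lz := rowLen_zero hl.le
  have az := rowLen_zero hlen.le
  have mz : ∀ i, l ≤ i → mu.rowLen i = 0 := fun i hi => by
    have := rowLen_mono hmu i; rw [lz i hi] at this; omega
  have bz : ∀ i, l ≤ i → bet.rowLen i = 0 := fun i hi => by
    have := rowLen_mono hbet i; rw [az i hi] at this; omega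
  have mlast : mu.rowLen (l - 1) = 0 := by
    have := hbasic1.2 0 (by omega)
    rw [hl] at this
    exact rowLen_zero (lam := mu) (l := l - 1) (by omega) _ le_rfl
  have blast : bet.rowLen (l - 1) = 0 := by
    have := hbasic2.2 0 (by have := aa (Nat.zero_le (l - 1)); omega)
    rw [hlen] at this
    exact rowLen_zero (lam := bet) (l := l - 1) (by omega) _ le_rfl
  have lJ : ∀ i, i < l → mu.rowLen 0 ≤ lam.rowLen i := fun i hi => by
    have := la (show i ≤ l - 1 by omega); omega
  have aJ : ∀ i, i < l → bet.rowLen 0 ≤ alp.rowLen i := fun i hi => by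
    have := aa (show i ≤ l - 1 by omega); omega
  have mJ : ∀ i, mu.rowLen i ≤ mu.rowLen 0 := fun i => ma (Nat.zero_le i)
  have bJ : ∀ i, bet.rowLen i ≤ bet.rowLen 0 := fun i => ba (Nat.zero_le i)
  have f1 := alt_factor (J := mu.rowLen 0) lz lJ hl0 mJ mz la ma
  have f2 := alt_factor (J := bet.rowLen 0) az aJ hl0 bJ bz aa ba
  have hs : ∑ G ∈ ggts l l lam.rowLen mu.rowLen lz, alt l (dl l (wt l G)) =
      ∑ G ∈ ggts l l alp.rowLen bet.rowLen az, alt l (dl l (wt l G)) := by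
    have := congrArg (fun s : Multiset (ℕ → ℕ) => (s.map fun v => alt l (dl l v)).sum)
      (wt_multiset hl.le hlen.le hmu hbet h)
    simp only [Multiset.map_map] at this
    exact this
  rw [hs, f2] at f1
  have key := alt_unique l _ _ _ _ (up_mono l (k1_anti (J := mu.rowLen 0) la))
    (up_mono l (k2_anti (l := l) (J := mu.rowLen 0) ma))
    (up_mono l (k1_anti (J := bet.rowLen 0) aa))
    (up_mono l (k2_anti (l := l) (J := bet.rowLen 0) ba))
    (by rw [alt_up, alt_up, alt_up, alt_up]; linear_combination
          (-((Equiv.Perm.sign (Fin.revPerm (n := l)) : ℤ) : MvPolynomial (Fin l) ℤ) ^ 2) * f1)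
  have val : ∀ (lam mu : YoungDiagram), (∀ i, i < l → mu.rowLen 0 ≤ lam.rowLen i) →
      (∀ i, mu.rowLen i ≤ mu.rowLen 0) → ∀ i : Fin l,
      (up l (k1 (mu.rowLen 0) lam.rowLen) i : ℤ) = i + lam.rowLen (l - 1 - i) - mu.rowLen 0 ∧
      (up l (k2 l (mu.rowLen 0) mu.rowLen) i : ℤ) = i + mu.rowLen 0 - mu.rowLen i := by
    intro lam mu q1 q2 i
    have w1 := q1 (l - 1 - i) (by omega)
    have w2 := q2 i
    simp only [up, k1, k2]
    rw [if_pos (by omega), show l - 1 - (l - 1 - (i : ℕ)) = i by omega]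
    omega
  have v1 := val lam mu lJ mJ
  have v2 := val alp bet aJ bJ
  rcases key with ⟨c, hc⟩ | ⟨c, hc⟩
  · left
    have rel : ∀ i, i < l → (alp.rowLen (l - 1 - i) : ℤ) - bet.rowLen 0 =
        lam.rowLen (l - 1 - i) - mu.rowLen 0 + c ∧
        (bet.rowLen 0 : ℤ) - bet.rowLen i = mu.rowLen 0 - mu.rowLen i - c := by
      intro i hi
      obtain ⟨c1, c2⟩ := hc ⟨i, hi⟩
      obtain ⟨x1, x2⟩ := v1 ⟨i, hi⟩
      obtain ⟨y1, y2⟩ := v2 ⟨i, hi⟩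
      simp only at x1 x2 y1 y2
      omega
    have r0 := (rel (l - 1) (by omega)).2
    rw [mlast, blast] at r0
    constructor
    · refine yd_ext fun i => ?_
      rcases Nat.lt_or_ge i l with hi | hi
      · have := (rel (l - 1 - i) (by omega)).1
        rw [show l - 1 - (l - 1 - i) = i by omega] at this
        omega
      · rw [lz i hi, az i hi]
    · refine yd_ext fun i => ?_
      rcases Nat.lt_or_ge i l with hi | hi
      · have := (rel i hi).2
        omega
      · rw [mz i hi, bz i hi]
  · right
    have rel : ∀ i, i < l → (alp.rowLen (l - 1 - i) : ℤ) - bet.rowLen 0 =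
        mu.rowLen 0 - mu.rowLen i + c ∧
        (bet.rowLen 0 : ℤ) - bet.rowLen i = lam.rowLen (l - 1 - i) - mu.rowLen 0 - c := by
      intro i hi
      obtain ⟨c1, c2⟩ := hc ⟨i, hi⟩
      obtain ⟨x1, x2⟩ := v1 ⟨i, hi⟩
      obtain ⟨y1, y2⟩ := v2 ⟨i, hi⟩
      simp only at x1 x2 y1 y2
      omega
    have r0 := (rel (l - 1) (by omega)).2
    rw [blast, Nat.sub_self] at r0
    constructor
    · refine yd_ext fun i => ?_
      rw [complRect_rowLen]
      rcases Nat.lt_or_ge i l with hi | hi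
      · rw [if_pos hi]
        have := (rel (l - 1 - i) (by omega)).1
        rw [show l - 1 - (l - 1 - i) = i by omega] at this
        omega
      · rw [if_neg (by omega), az i hi]
    · refine yd_ext fun i => ?_
      rw [complRect_rowLen]
      rcases Nat.lt_or_ge i l with hi | hi
      · rw [if_pos hi]
        have := (rel i hi).2
        omega
      · rw [if_neg (by omega), bz i hi]

/-- if `lam/mu` has a row of full length `lam_1` and a column of full height
`length(lam)`, then any basic skew diagram with the same skew Schur function equals `lam/mu`
or its 180°-rotation. -/
theorem eq_or_rotation_of_full_row_col (lam mu alp bet : YoungDiagram)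
    (hmu : mu ≤ lam) (hbet : bet ≤ alp)
    (hbasic1 : IsBasic lam mu) (hbasic2 : IsBasic alp bet)
    (hrow : ∃ i, i < lam.colLen 0 ∧ mu.rowLen i = 0 ∧ lam.rowLen i = lam.rowLen 0)
    (hcol : ∃ j, j < lam.rowLen 0 ∧ mu.colLen j = 0 ∧ lam.colLen j = lam.colLen 0)
    (h : SchurEq lam mu alp bet) :
    (alp = lam ∧ bet = mu) ∨
      (alp = complRect (lam.rowLen 0) (lam.colLen 0) mu ∧
        bet = complRect (lam.rowLen 0) (lam.colLen 0) lam) := 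
  main_aux lam mu alp bet hmu hbet hbasic1 hbasic2 hcol h

end LRSkew
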